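/- arXiv:2311.03064 — 4 statements merged into one kernel-verified Lean document; each statement's English description precedes it below -/
import Mathlib

section
/- Let X and Y be real Banach spaces and let X ⊕_∞ Y denote their direct sum with norm ‖(x,y)‖ = max{‖x‖,‖y‖}. Then (a,b) is an SCD point of B_{X⊕_∞Y} if and only if a is an SCD point of B_X and b is an SCD point of B_Y. -/
open Set Metric

variable {X : Type*} [NormedAddCommGroup X] [NormedSpace ℝ X]

/-- A slice of a bounded convex set `A`. -/
def IsSlice (A S : Set X) : Prop :=
  S.Nonempty ∧ ∃ (f : X →L[ℝ] ℝ) (α : ℝ), 0 < α ∧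
    S = {x | x ∈ A ∧ sSup (f '' A) - α < f x}

/-- `V` is a determining sequence for the point `a` of `A`. -/
def Determining (A : Set X) (V : ℕ → Set X) (a : X) : Prop :=
  ∀ B ⊆ A, (∀ n, (B ∩ V n).Nonempty) → a ∈ closure (convexHull ℝ B)

/-- `a` is a slicely countably determined point of `A`. -/
def SCDPoint (A : Set X) (a : X) : Prop :=
  a ∈ A ∧ ∃ V : ℕ → Set X, (∀ n, IsSlice A (V n)) ∧ Determining A V a

lemma slice_mk {E : Type*} [NormedAddCommGroup E] [NormedSpace ℝ E] {A : Set E}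
    (hA : A.Nonempty) (f : E →L[ℝ] ℝ) {α : ℝ} (hα : 0 < α) :
    IsSlice A {x | x ∈ A ∧ sSup (f '' A) - α < f x} := by
  refine ⟨?_, f, α, hα, rfl⟩
  obtain ⟨_, ⟨x, hx, rfl⟩, h⟩ := exists_lt_of_lt_csSup (hA.image f)
    (show sSup (f '' A) - α < sSup (f '' A) by linarith)
  exact ⟨x, hx, h⟩

lemma bdd_image {E : Type*} [NormedAddCommGroup E] [NormedSpace ℝ E] {A : Set E}
    (hA : Bornology.IsBounded A) (f : E →L[ℝ] ℝ) : BddAbove (f '' A) :=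
  (f.lipschitz.isBounded_image hA).bddAbove

lemma sSup_image_prod_add {E F : Type*} [NormedAddCommGroup E] [NormedSpace ℝ E]
    [NormedAddCommGroup F] [NormedSpace ℝ F] {A : Set E} {C : Set F}
    (hA : A.Nonempty) (hC : C.Nonempty) (hAb : Bornology.IsBounded A)
    (hCb : Bornology.IsBounded C) (h : E × F →L[ℝ] ℝ) (f : E →L[ℝ] ℝ) (g : F →L[ℝ] ℝ)
    (hfg : ∀ x y, h (x, y) = f x + g y) :
    sSup (h '' (A ×ˢ C)) = sSup (f '' A) + sSup (g '' C) := by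
  open Pointwise in
  have e : h '' (A ×ˢ C) = f '' A + g '' C := by
    ext t
    simp only [Set.mem_add, Set.mem_image, Prod.exists, Set.mem_prod]
    constructor
    · rintro ⟨x, y, ⟨hx, hy⟩, rfl⟩
      exact ⟨_, ⟨x, hx, rfl⟩, _, ⟨y, hy, rfl⟩, (hfg x y).symm⟩
    · rintro ⟨_, ⟨x, hx, rfl⟩, _, ⟨y, hy, rfl⟩, rfl⟩
      exact ⟨x, y, ⟨hx, hy⟩, hfg x y⟩
  rw [e, csSup_add (hA.image f) (bdd_image hAb f) (hC.image g) (bdd_image hCb g)]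

lemma scd_fst {E F : Type*} [NormedAddCommGroup E] [NormedSpace ℝ E]
    [NormedAddCommGroup F] [NormedSpace ℝ F] {A : Set E} {C : Set F}
    (hAb : Bornology.IsBounded A) (hCb : Bornology.IsBounded C) {a : E} {b : F}
    (h : SCDPoint (A ×ˢ C) (a, b)) : SCDPoint A a := by
  obtain ⟨⟨ha, hb⟩, V, hV, hdet⟩ := h
  have hA : A.Nonempty := ⟨a, ha⟩
  have hC : C.Nonempty := ⟨b, hb⟩
  choose hne f α hα hVe using hV
  refine ⟨ha, fun n => _, fun n => slice_mk hA
    ((f n).comp (ContinuousLinearMap.inl ℝ E F)) (half_pos (hα n)), ?_⟩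
  intro B hB hBn
  choose x hxB hx using hBn
  choose y hy using fun n => (slice_mk hC
    ((f n).comp (ContinuousLinearMap.inr ℝ E F)) (half_pos (hα n))).1
  have key := hdet (Set.range fun n => (x n, y n)) ?_ ?_
  · have h1 : a ∈ Prod.fst '' closure (convexHull ℝ (Set.range fun n => (x n, y n))) :=
      ⟨_, key, rfl⟩
    have h2 := image_closure_subset_closure_image continuous_fst h1
    refine closure_mono ?_ h2
    have h3 := (LinearMap.fst ℝ E F).image_convexHull (Set.range fun n => (x n, y n))
    change (LinearMap.fst ℝ E F) '' _ ⊆ _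
    rw [h3]
    apply convexHull_mono
    rintro _ ⟨_, ⟨n, rfl⟩, rfl⟩
    exact hxB n
  · rintro _ ⟨n, rfl⟩
    exact ⟨(hx n).1, (hy n).1⟩
  · intro n
    refine ⟨_, ⟨n, rfl⟩, ?_⟩
    rw [hVe]
    refine ⟨⟨(hx n).1, (hy n).1⟩, ?_⟩
    have e : ∀ x y, f n (x, y) = ((f n).comp (ContinuousLinearMap.inl ℝ E F)) x +
        ((f n).comp (ContinuousLinearMap.inr ℝ E F)) y := by
      intro x y
      simp [← map_add]
    rw [sSup_image_prod_add hA hC hAb hCb _ _ _ e, e]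
    have h1 := (hx n).2
    have h2 := (hy n).2
    linarith

lemma scd_snd {E F : Type*} [NormedAddCommGroup E] [NormedSpace ℝ E]
    [NormedAddCommGroup F] [NormedSpace ℝ F] {A : Set E} {C : Set F}
    (hAb : Bornology.IsBounded A) (hCb : Bornology.IsBounded C) {a : E} {b : F}
    (h : SCDPoint (A ×ˢ C) (a, b)) : SCDPoint C b := by
  obtain ⟨⟨ha, hb⟩, V, hV, hdet⟩ := h
  have hA : A.Nonempty := ⟨a, ha⟩
  have hC : C.Nonempty := ⟨b, hb⟩
  choose hne f α hα hVe using hV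
  refine ⟨hb, fun n => _, fun n => slice_mk hC
    ((f n).comp (ContinuousLinearMap.inr ℝ E F)) (half_pos (hα n)), ?_⟩
  intro B hB hBn
  choose y hyB hy using hBn
  choose x hx using fun n => (slice_mk hA
    ((f n).comp (ContinuousLinearMap.inl ℝ E F)) (half_pos (hα n))).1
  have key := hdet (Set.range fun n => (x n, y n)) ?_ ?_
  · have h1 : b ∈ Prod.snd '' closure (convexHull ℝ (Set.range fun n => (x n, y n))) :=
      ⟨_, key, rfl⟩
    have h2 := image_closure_subset_closure_image continuous_snd h1
    refine closure_mono ?_ h2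
    have h3 := (LinearMap.snd ℝ E F).image_convexHull (Set.range fun n => (x n, y n))
    change (LinearMap.snd ℝ E F) '' _ ⊆ _
    rw [h3]
    apply convexHull_mono
    rintro _ ⟨_, ⟨n, rfl⟩, rfl⟩
    exact hyB n
  · rintro _ ⟨n, rfl⟩
    exact ⟨(hx n).1, (hy n).1⟩
  · intro n
    refine ⟨_, ⟨n, rfl⟩, ?_⟩
    rw [hVe]
    refine ⟨⟨(hx n).1, (hy n).1⟩, ?_⟩
    have e : ∀ x y, f n (x, y) = ((f n).comp (ContinuousLinearMap.inl ℝ E F)) x +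
        ((f n).comp (ContinuousLinearMap.inr ℝ E F)) y := by
      intro x y
      simp [← map_add]
    rw [sSup_image_prod_add hA hC hAb hCb _ _ _ e, e]
    have h1 := (hx n).2
    have h2 := (hy n).2
    linarith

lemma slice_convex {E : Type*} [NormedAddCommGroup E] [NormedSpace ℝ E] {A S : Set E}
    (hA : Convex ℝ A) (hS : IsSlice A S) : Convex ℝ S := by
  obtain ⟨-, f, α, -, rfl⟩ := hS
  exact hA.inter (convex_halfSpace_gt f.toLinearMap.isLinear _)

lemma scd_prod {E F : Type*} [NormedAddCommGroup E] [NormedSpace ℝ E]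
    [NormedAddCommGroup F] [NormedSpace ℝ F] {A : Set E} {C : Set F}
    (hAc : Convex ℝ A)
    (hAb : Bornology.IsBounded A) (hCb : Bornology.IsBounded C) {a : E} {b : F}
    (h : SCDPoint A a) (h' : SCDPoint C b) : SCDPoint (A ×ˢ C) (a, b) := by
  obtain ⟨ha, V, hV, hdet⟩ := h
  obtain ⟨hb, W, hW, hdet'⟩ := h'
  have hA : A.Nonempty := ⟨a, ha⟩
  have hC : C.Nonempty := ⟨b, hb⟩
  have hVc := fun n => slice_convex hAc (hV n)
  have hVA : ∀ n, V n ⊆ A := by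
    intro n
    obtain ⟨-, f, α, -, e⟩ := hV n
    rw [e]
    exact fun x hx => hx.1
  have hWC : ∀ n, W n ⊆ C := by
    intro n
    obtain ⟨-, f, α, -, e⟩ := hW n
    rw [e]
    exact fun x hx => hx.1
  have hU : ∀ p : ℕ × ℕ, ∃ U : Set (E × F), IsSlice (A ×ˢ C) U ∧ U ⊆ V p.1 ×ˢ W p.2 := by
    rintro ⟨n, m⟩
    obtain ⟨-, f, α, hα, e⟩ := hV n
    obtain ⟨-, g, β, hβ, e'⟩ := hW m
    refine ⟨_, slice_mk (hA.prod hC) (f.coprod g) (lt_min hα hβ), ?_⟩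
    rw [sSup_image_prod_add hA hC hAb hCb (f.coprod g) f g (by simp)]
    rintro ⟨x, y⟩ ⟨⟨hx, hy⟩, hlt⟩
    have h1 := le_csSup (bdd_image hAb f) (Set.mem_image_of_mem f hx)
    have h2 := le_csSup (bdd_image hCb g) (Set.mem_image_of_mem g hy)
    have h3 := min_le_left α β
    have h4 := min_le_right α β
    simp only [ContinuousLinearMap.coprod_apply] at hlt
    dsimp only at hx hy
    show x ∈ V n ∧ y ∈ W m
    rw [e, e']
    exact ⟨⟨hx, by linarith⟩, ⟨hy, by linarith⟩⟩
  choose U hUs hUsub using hU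
  refine ⟨⟨ha, hb⟩, fun k => U k.unpair, fun k => hUs _, ?_⟩
  intro B hB hBn
  have hBU : ∀ n m, ∃ x y, (x, y) ∈ B ∧ x ∈ V n ∧ y ∈ W m := by
    intro n m
    obtain ⟨⟨x, y⟩, hxB, hxU⟩ := hBn (Nat.pair n m)
    simp only [Nat.unpair_pair] at hxU
    have := hUsub _ hxU
    exact ⟨x, y, hxB, this.1, this.2⟩
  choose x y hxyB hxV hyW using hBU
  rw [Metric.mem_closure_iff]
  intro ε hε
  have step : ∀ n, ∃ p ∈ convexHull ℝ B, p.1 ∈ V n ∧ p.2 ∈ Metric.ball b ε := by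
    intro n
    have h1 := hdet' (Set.range (y n)) (by rintro _ ⟨m, rfl⟩; exact hWC m (hyW n m))
      (fun m => ⟨y n m, ⟨m, rfl⟩, hyW n m⟩)
    obtain ⟨y', hy', hd⟩ := Metric.mem_closure_iff.1 h1 ε hε
    have h3 := (LinearMap.snd ℝ E F).image_convexHull (Set.range fun m => (x n m, y n m))
    have h4 : (LinearMap.snd ℝ E F) '' (Set.range fun m => (x n m, y n m)) =
        Set.range (y n) := by
      rw [← Set.range_comp]; rfl
    rw [← h4, ← h3] at hy'
    obtain ⟨p, hp, rfl⟩ := hy'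
    refine ⟨p, convexHull_mono ?_ hp, ?_, ?_⟩
    · rintro _ ⟨m, rfl⟩
      exact hxyB n m
    · have : (Set.range fun m => (x n m, y n m)) ⊆ (LinearMap.fst ℝ E F) ⁻¹' (V n) := by
        rintro _ ⟨m, rfl⟩
        exact hxV n m
      exact convexHull_min this ((hVc n).linear_preimage _) hp
    · rw [Metric.mem_ball, dist_comm]; exact hd
  choose p hpB hpV hpb using step
  have h1 := hdet (Set.range fun n => (p n).1)
    (by rintro _ ⟨m, rfl⟩; exact hVA m (hpV m)) (fun m => ⟨(p m).1, ⟨m, rfl⟩, hpV m⟩)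
  obtain ⟨x', hx', hd⟩ := Metric.mem_closure_iff.1 h1 ε hε
  have h3 := (LinearMap.fst ℝ E F).image_convexHull (Set.range p)
  have h4 : (LinearMap.fst ℝ E F) '' (Set.range p) = Set.range fun n => (p n).1 := by
    rw [← Set.range_comp]; rfl
  rw [← h4, ← h3] at hx'
  obtain ⟨q, hq, rfl⟩ := hx'
  refine ⟨q, convexHull_min ?_ (convex_convexHull ℝ B) hq, ?_⟩
  · rintro _ ⟨n, rfl⟩
    exact hpB n
  · have h5 : Set.range p ⊆ (LinearMap.snd ℝ E F) ⁻¹' (Metric.ball b ε) := by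
      rintro _ ⟨m, rfl⟩
      exact hpb m
    have h6 := convexHull_min h5 ((convex_ball b ε).linear_preimage _) hq
    rw [Prod.dist_eq]
    refine max_lt hd ?_
    rw [dist_comm]
    exact h6

/-- `(a,b)` is an SCD point of the unit ball of `X ⊕_∞ Y` (the product with
the max norm, which is the norm of `X × Y` in Mathlib) iff `a` is an SCD point of `B_X`
and `b` is an SCD point of `B_Y`. -/
theorem stmt11 {X Y : Type*} [NormedAddCommGroup X] [NormedSpace ℝ X] [CompleteSpace X]
    [NormedAddCommGroup Y] [NormedSpace ℝ Y] [CompleteSpace Y] (a : X) (b : Y) :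
    SCDPoint (Metric.closedBall (0 : X × Y) 1) (a, b) ↔
      SCDPoint (Metric.closedBall (0 : X) 1) a ∧ SCDPoint (Metric.closedBall (0 : Y) 1) b := by
  have e : Metric.closedBall (0 : X × Y) 1 =
      Metric.closedBall (0 : X) 1 ×ˢ Metric.closedBall (0 : Y) 1 :=
    (closedBall_prod_same (0 : X) (0 : Y) 1).symm
  rw [e]
  exact ⟨fun h => ⟨scd_fst Metric.isBounded_closedBall Metric.isBounded_closedBall h,
    scd_snd Metric.isBounded_closedBall Metric.isBounded_closedBall h⟩,
    fun h => scd_prod (convex_closedBall _ _) Metric.isBounded_closedBall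
      Metric.isBounded_closedBall h.1 h.2⟩
end

section
/- Let X and Y be real Banach spaces, let X ⊕_1 Y denote their direct sum with norm ‖(x,y)‖ = ‖x‖ + ‖y‖, and let (a,b) ∈ X ⊕_1 Y with ‖a‖ + ‖b‖ = 1, a ≠ 0 and b ≠ 0. Then (a,b) is an SCD point of B_{X⊕_1Y} if and only if a/‖a‖ is an SCD point of B_X and b/‖b‖ is an SCD point of B_Y. -/
open Set Metric

variable {X : Type*} [NormedAddCommGroup X] [NormedSpace ℝ X]

section helpers

variable {Z : Type*} [NormedAddCommGroup Z] [NormedSpace ℝ Z]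
variable {E : Type*} [NormedAddCommGroup E] [NormedSpace ℝ E]
variable {F : Type*} [NormedAddCommGroup F] [NormedSpace ℝ F]

lemma isSlice_subset {A S : Set E} (h : IsSlice A S) : S ⊆ A := by
  obtain ⟨_, f, α, _, rfl⟩ := h
  exact fun x hx => hx.1

lemma le_opNorm_of_mem (f : E →L[ℝ] ℝ) {x : E} (hx : x ∈ closedBall (0 : E) 1) : f x ≤ ‖f‖ := by
  have h1 : ‖x‖ ≤ 1 := by simpa using hx
  calc f x ≤ ‖f x‖ := Real.le_norm_self _
    _ ≤ ‖f‖ * ‖x‖ := f.le_opNorm x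
    _ ≤ ‖f‖ * 1 := by gcongr
    _ = ‖f‖ := mul_one _

lemma isSlice_of (f : E →L[ℝ] ℝ) (c : ℝ)
    (h : {x | x ∈ closedBall (0 : E) 1 ∧ c < f x}.Nonempty) :
    IsSlice (closedBall (0 : E) 1) {x | x ∈ closedBall (0 : E) 1 ∧ c < f x} := by
  refine ⟨h, f, sSup (f '' closedBall (0 : E) 1) - c, ?_, ?_⟩
  · obtain ⟨x, hx, hc⟩ := h
    have : f x ≤ sSup (f '' closedBall (0 : E) 1) := by
      apply le_csSup
      · refine ⟨‖f‖, ?_⟩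
        rintro _ ⟨y, hy, rfl⟩
        exact le_opNorm_of_mem f hy
      · exact ⟨x, hx, rfl⟩
    linarith
  · simp

lemma determining_iff {A : Set E} {V : ℕ → Set E} (hV : ∀ n, V n ⊆ A) (a : E) :
    Determining A V a ↔ ∀ (f : E →L[ℝ] ℝ) (c : ℝ), c < f a → ∃ n, ∀ x ∈ V n, c < f x := by
  constructor
  · intro h f c hc
    by_contra! hcon
    choose x hx hxc using hcon
    have h1 := h (range x) (by rintro _ ⟨n, rfl⟩; exact hV n (hx n))
      (fun n => ⟨x n, ⟨n, rfl⟩, hx n⟩)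
    have h2 : closure (convexHull ℝ (range x)) ⊆ {y | f y ≤ c} := by
      apply closure_minimal
      · apply convexHull_min
        · rintro _ ⟨n, rfl⟩
          exact hxc n
        · exact convex_halfSpace_le f.toLinearMap.isLinear c
      · exact isClosed_le f.continuous continuous_const
    have h3 : f a ≤ c := h2 h1
    linarith
  · intro h B hBA hB
    by_contra hcon
    obtain ⟨f, u, hu1, hu2⟩ := geometric_hahn_banach_closed_point
      ((convex_convexHull ℝ B).closure) isClosed_closure hcon
    obtain ⟨n, hn⟩ := h f u hu2
    obtain ⟨x, hxB, hxV⟩ := hB n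
    have h1 := hn x hxV
    have h2 := hu1 x (subset_closure (subset_convexHull ℝ B hxB))
    linarith

lemma scd_of {ι : Type*} [Countable ι] [Nonempty ι] {A : Set E} {a : E} (ha : a ∈ A)
    (V : ι → Set E) (hV : ∀ n, IsSlice A (V n))
    (h : ∀ (f : E →L[ℝ] ℝ) (c : ℝ), c < f a → ∃ n, ∀ x ∈ V n, c < f x) : SCDPoint A a := by
  obtain ⟨e, he⟩ := exists_surjective_nat ι
  refine ⟨ha, fun n => V (e n), fun n => hV _, ?_⟩
  rw [determining_iff (fun n => isSlice_subset (hV _))]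
  intro f c hc
  obtain ⟨i, hi⟩ := h f c hc
  obtain ⟨n, rfl⟩ := he i
  exact ⟨n, hi⟩

lemma scd_get {A : Set E} {a : E} (h : SCDPoint A a) : ∃ V : ℕ → Set E, (∀ n, IsSlice A (V n)) ∧
    ∀ (f : E →L[ℝ] ℝ) (c : ℝ), c < f a → ∃ n, ∀ x ∈ V n, c < f x := by
  obtain ⟨_, V, hV, hd⟩ := h
  exact ⟨V, hV, (determining_iff (fun n => isSlice_subset (hV _)) a).1 hd⟩

lemma scd_convex {A : Set E} (hA : Convex ℝ A) {a b : E} (ha : SCDPoint A a) (hb : SCDPoint A b)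
    {s t : ℝ} (hs : 0 ≤ s) (ht : 0 ≤ t) (hst : s + t = 1) : SCDPoint A (s • a + t • b) := by
  obtain ⟨V, hV, hVd⟩ := scd_get ha
  obtain ⟨W, hW, hWd⟩ := scd_get hb
  refine scd_of (ι := ℕ ⊕ ℕ) (hA ha.1 hb.1 hs ht hst) (Sum.elim V W) ?_ ?_
  · rintro (n | n)
    · exact hV n
    · exact hW n
  · intro f c hc
    by_cases h1 : c < f a
    · obtain ⟨n, hn⟩ := hVd f c h1
      exact ⟨Sum.inl n, hn⟩
    · by_cases h2 : c < f b
      · obtain ⟨n, hn⟩ := hWd f c h2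
        exact ⟨Sum.inr n, hn⟩
      · exfalso
        simp only [map_add, map_smul, smul_eq_mul] at hc
        have h3 : s * f a ≤ s * c := by gcongr; linarith
        have h4 : t * f b ≤ t * c := by gcongr; linarith
        have h5 : s * c + t * c = c := by rw [← add_mul, hst, one_mul]
        linarith

lemma exists_norming {u : E} (hu : ‖u‖ = 1) : ∃ φ : E →L[ℝ] ℝ, ‖φ‖ = 1 ∧ φ u = 1 := by
  obtain ⟨g, h1, h2⟩ := exists_dual_vector ℝ u (by rw [hu]; norm_num)
  exact ⟨g, h1, by simpa [hu] using h2⟩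

lemma slice_sub {u : E} (hu : ‖u‖ = 1) {S : Set E} (hS : IsSlice (closedBall (0 : E) 1) S) :
    ∃ h : E →L[ℝ] ℝ, ∃ α : ℝ, ‖h‖ = 1 ∧ 0 < α ∧
      ∀ x ∈ closedBall (0 : E) 1, 1 - α < h x → x ∈ S := by
  obtain ⟨_, f, α, hα, rfl⟩ := hS
  have hsup : sSup (f '' closedBall (0 : E) 1) ≤ ‖f‖ := by
    apply csSup_le
    · exact ⟨f 0, 0, by simp, rfl⟩
    · rintro _ ⟨y, hy, rfl⟩
      exact le_opNorm_of_mem f hy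
  by_cases hf : f = 0
  · obtain ⟨φ, hφ, _⟩ := exists_norming hu
    refine ⟨φ, 1, hφ, one_pos, fun x hx _ => ⟨hx, ?_⟩⟩
    subst hf
    simp only [norm_zero] at hsup
    simp only [ContinuousLinearMap.zero_apply] at *
    linarith
  · have hpos : 0 < ‖f‖ := norm_pos_iff.2 hf
    refine ⟨‖f‖⁻¹ • f, α / ‖f‖, ?_, by positivity, fun x hx h => ⟨hx, ?_⟩⟩
    · rw [norm_smul, norm_inv, norm_norm, inv_mul_cancel₀ hpos.ne']
    · simp only [ContinuousLinearMap.smul_apply, smul_eq_mul] at h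
      have h2 := mul_lt_mul_of_pos_left h hpos
      rw [mul_inv_cancel_left₀ hpos.ne', mul_sub, mul_one, mul_div_cancel₀ _ hpos.ne'] at h2
      linarith

lemma exists_near {h : E →L[ℝ] ℝ} (hh : ‖h‖ = 1) {δ : ℝ} (hδ : 0 < δ) :
    ∃ x ∈ closedBall (0 : E) 1, 1 - δ < h x := by
  obtain ⟨x, hx, h2⟩ := h.exists_lt_apply_of_lt_opNorm (r := 1 - δ) (by rw [hh]; linarith)
  rcases le_total 0 (h x) with h0 | h0
  · exact ⟨x, by simpa using hx.le, by rwa [Real.norm_of_nonneg h0] at h2⟩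
  · exact ⟨-x, by simpa using hx.le, by rwa [Real.norm_of_nonpos h0, ← map_neg] at h2⟩

lemma scd_incl (i : E →L[ℝ] Z) (j : F →L[ℝ] Z) (p : Z →L[ℝ] E) (q : Z →L[ℝ] F)
    (hpi : ∀ x, p (i x) = x) (hqi : ∀ x, q (i x) = 0)
    (hz : ∀ z, i (p z) + j (q z) = z) (hn : ∀ z, ‖z‖ = ‖p z‖ + ‖q z‖)
    {u : E} (hu : ‖u‖ = 1) (h : SCDPoint (closedBall (0 : E) 1) u) :
    SCDPoint (closedBall (0 : Z) 1) (i u) := by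
  have hi : ∀ x, ‖i x‖ = ‖x‖ := fun x => by rw [hn, hpi, hqi]; simp
  obtain ⟨V, hV, hVd⟩ := scd_get h
  choose g α hg hα hgV using fun n => slice_sub hu (hV n)
  have hδ : ∀ k : ℕ × ℕ, 0 < min (α k.1) (1 / ((k.2 : ℝ) + 1)) := fun k =>
    lt_min (hα _) (by positivity)
  refine scd_of (ι := ℕ × ℕ) (by simp [hi, hu]) (fun k => {z | z ∈ closedBall (0 : Z) 1 ∧
    1 - min (α k.1) (1 / ((k.2 : ℝ) + 1)) < ((g k.1).comp p) z}) ?_ ?_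
  · intro k
    apply isSlice_of
    obtain ⟨x, hx, hx2⟩ := exists_near (hg k.1) (hδ k)
    refine ⟨i x, ?_, ?_⟩
    · simpa [hi] using hx
    · simpa [hpi] using hx2
  · intro G c hc
    obtain ⟨n, hn'⟩ := hVd (G.comp i) ((c + G (i u)) / 2) (by
      simp only [ContinuousLinearMap.comp_apply]; linarith)
    set ε := (G (i u) - c) / 2 with hε
    have hεpos : 0 < ε := by rw [hε]; linarith
    have hKpos : 0 < ‖G.comp j‖ + 1 := by positivity
    obtain ⟨k, hk⟩ := exists_nat_one_div_lt (div_pos hεpos hKpos)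
    refine ⟨(n, k), ?_⟩
    rintro z ⟨hz1, hz2⟩
    simp only [ContinuousLinearMap.comp_apply] at hz2
    have hzn : ‖p z‖ + ‖q z‖ ≤ 1 := by rw [← hn]; simpa using hz1
    have hpz : p z ∈ closedBall (0 : E) 1 := by
      simp only [mem_closedBall, dist_zero_right]; linarith [norm_nonneg (q z)]
    have hpV : p z ∈ V n := hgV n _ hpz (by
      have := min_le_left (α n) (1 / ((k : ℝ) + 1)); linarith)
    have h1 := hn' _ hpV
    simp only [ContinuousLinearMap.comp_apply] at h1
    have h2 : g n (p z) ≤ ‖p z‖ := by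
      calc g n (p z) ≤ ‖g n (p z)‖ := Real.le_norm_self _
        _ ≤ ‖g n‖ * ‖p z‖ := (g n).le_opNorm _
        _ = ‖p z‖ := by rw [hg, one_mul]
    have h3 : ‖q z‖ ≤ 1 / ((k : ℝ) + 1) := by
      have := min_le_right (α n) (1 / ((k : ℝ) + 1)); linarith
    have h4 : ‖G (j (q z))‖ ≤ ‖G.comp j‖ * ‖q z‖ := (G.comp j).le_opNorm (q z)
    have h5 : (‖G.comp j‖ + 1) * ‖q z‖ < ε := by
      rw [mul_comm]; exact (lt_div_iff₀ hKpos).1 (lt_of_le_of_lt h3 hk)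
    have h6 := neg_abs_le (G (j (q z)))
    rw [Real.norm_eq_abs] at h4
    have h7 : G z = G (i (p z)) + G (j (q z)) := by rw [← map_add, hz]
    have h8 := norm_nonneg (q z)
    rw [h7]
    nlinarith

lemma le_of_ball (f : E →L[ℝ] ℝ) (d : ℝ) (h : ∀ x ∈ closedBall (0 : E) 1, f x ≤ d) (x : E) :
    f x ≤ ‖x‖ * d := by
  by_cases hx : x = 0
  · simp [hx]
  · have hpos : 0 < ‖x‖ := norm_pos_iff.2 hx
    have h1 := h (‖x‖⁻¹ • x) (by simp [norm_smul, hpos.ne'])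
    rw [map_smul, smul_eq_mul, inv_mul_le_iff₀ hpos] at h1
    exact h1

lemma scd_proj (i : E →L[ℝ] Z) (j : F →L[ℝ] Z) (p : Z →L[ℝ] E) (q : Z →L[ℝ] F)
    (hpi : ∀ x, p (i x) = x) (hqi : ∀ x, q (i x) = 0)
    (hpj : ∀ x, p (j x) = 0) (hqj : ∀ x, q (j x) = x)
    (hz : ∀ z, i (p z) + j (q z) = z) (hn : ∀ z, ‖z‖ = ‖p z‖ + ‖q z‖)
    {u : E} (hu : ‖u‖ = 1) {v : F} (hv : ‖v‖ = 1) {l m : ℝ} (hl : 0 < l) (hm : 0 < m)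
    (hlm : l + m = 1)
    (h : SCDPoint (closedBall (0 : Z) 1) (l • i u + m • j v)) :
    SCDPoint (closedBall (0 : E) 1) u := by
  have hi : ∀ x, ‖i x‖ = ‖x‖ := fun x => by rw [hn, hpi, hqi]; simp
  have hj : ∀ x, ‖j x‖ = ‖x‖ := fun x => by rw [hn, hpj, hqj]; simp
  obtain ⟨U, hU, hUd⟩ := scd_get h
  have hV : ∀ n, ∃ V : Set E, IsSlice (closedBall (0 : E) 1) V ∧
      ((∃ x, i x ∈ U n) → V = {x | i x ∈ U n}) := by
    intro n
    by_cases hne : ∃ x, i x ∈ U n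
    · refine ⟨{x | i x ∈ U n}, ?_, fun _ => rfl⟩
      obtain ⟨_, G, α, hα, hUn⟩ := hU n
      have : {x | i x ∈ U n} = {x | x ∈ closedBall (0 : E) 1 ∧
          sSup (G '' closedBall (0 : Z) 1) - α < (G.comp i) x} := by
        ext x
        simp [hUn, hi]
      rw [this]
      apply isSlice_of
      rw [← this]
      exact hne
    · refine ⟨{x | x ∈ closedBall (0 : E) 1 ∧ -1 < (0 : E →L[ℝ] ℝ) x}, isSlice_of _ _ ?_,
        fun h => absurd h hne⟩
      exact ⟨0, by simp⟩
  choose V hVs hVe using hV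
  refine scd_of (by simp [hu]) V hVs ?_
  intro f c hc
  obtain ⟨φ, hφ, hφu⟩ := exists_norming hu
  obtain ⟨γ, hγ, hγv⟩ := exists_norming hv
  obtain ⟨η, hη⟩ : ∃ η, η = l * (f u - c) := ⟨_, rfl⟩
  have hηpos : 0 < η := by rw [hη]; exact mul_pos hl (by linarith)
  obtain ⟨t, ht⟩ : ∃ t, t = η + |c| := ⟨_, rfl⟩
  have htpos : 0 ≤ t := by rw [ht]; positivity
  obtain ⟨s, hs⟩ : ∃ s, s = c + |c| := ⟨_, rfl⟩
  have hspos : 0 ≤ s := by rw [hs]; linarith [neg_abs_le c]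
  obtain ⟨n, hn'⟩ := hUd ((f + t • φ).comp p + s • γ.comp q) (c + t) (by
    simp only [ContinuousLinearMap.add_apply, ContinuousLinearMap.comp_apply,
      ContinuousLinearMap.smul_apply, map_add, map_smul, hpi, hqi, hpj, hqj, hφu, hγv, smul_eq_mul,
      map_zero]
    have h1 : m * η < η := by nlinarith
    have h2 : s = c + t - η := by rw [hs, ht]; ring
    have h3 : m = 1 - l := by linarith
    rw [h2]
    have h4 : l * f u = η + l * c := by rw [hη]; ring
    have h5 : m * c = c - l * c := by rw [h3]; ring
    have h6 : m * t = t - l * t := by rw [h3]; ring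
    have h7 : m * (c + t - η) = m * c + m * t - m * η := by ring
    simp only [mul_zero, mul_one, add_zero, zero_add]
    linarith [mul_comm m (c + t - η)])
  simp only [ContinuousLinearMap.add_apply, ContinuousLinearMap.comp_apply,
      ContinuousLinearMap.smul_apply, smul_eq_mul] at hn'
  have hex : ∃ x, i x ∈ U n := by
    by_contra! hcon
    obtain ⟨⟨z, hzU⟩, G, α, hα, hUn⟩ := hU n
    obtain ⟨d, hd⟩ : ∃ d, d = sSup (G '' closedBall (0 : Z) 1) - α := ⟨_, rfl⟩
    rw [← hd] at hUn
    have hI : ∀ x ∈ closedBall (0 : E) 1, (G.comp i) x ≤ d := by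
      intro x hx
      by_contra! hlt
      apply hcon x
      rw [hUn]
      exact ⟨by simpa [hi] using hx, hlt⟩
    have hJ : ∀ y ∈ closedBall (0 : F) 1, (G.comp j) y ≤ d := by
      intro y hy
      by_contra! hlt
      have h1 : j y ∈ U n := by
        rw [hUn]
        exact ⟨by simpa [hj] using hy, hlt⟩
      have h2 := hn' _ h1
      simp only [hpj, hqj, map_zero, mul_zero, add_zero, zero_add] at h2
      have h3 := le_opNorm_of_mem γ hy
      rw [hγ] at h3
      have h4 : s * γ y ≤ s := by nlinarith
      linarith
    have hd0 : 0 ≤ d := by simpa using hI 0 (by simp)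
    have h1 := le_of_ball _ d hI (p z)
    have h2 := le_of_ball _ d hJ (q z)
    simp only [ContinuousLinearMap.comp_apply] at h1 h2
    rw [hUn] at hzU
    have h3 : ‖p z‖ + ‖q z‖ ≤ 1 := by rw [← hn]; simpa using hzU.1
    have h4 : G z = G (i (p z)) + G (j (q z)) := by rw [← map_add, hz]
    have h5 := hzU.2
    nlinarith
  refine ⟨n, fun x hx => ?_⟩
  have hxb := isSlice_subset (hVs n) hx
  rw [hVe n hex] at hx
  have h1 := hn' _ hx
  simp only [hpi, hqi, map_zero, mul_zero, add_zero] at h1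
  have h3 := le_opNorm_of_mem φ hxb
  rw [hφ] at h3
  have h4 : t * φ x ≤ t := by nlinarith
  linarith

lemma scd_iff (i : E →L[ℝ] Z) (j : F →L[ℝ] Z) (p : Z →L[ℝ] E) (q : Z →L[ℝ] F)
    (hpi : ∀ x, p (i x) = x) (hqi : ∀ x, q (i x) = 0)
    (hpj : ∀ x, p (j x) = 0) (hqj : ∀ x, q (j x) = x)
    (hz : ∀ z, i (p z) + j (q z) = z) (hn : ∀ z, ‖z‖ = ‖p z‖ + ‖q z‖)
    {u : E} (hu : ‖u‖ = 1) {v : F} (hv : ‖v‖ = 1) {l m : ℝ} (hl : 0 < l) (hm : 0 < m)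
    (hlm : l + m = 1) :
    SCDPoint (closedBall (0 : Z) 1) (l • i u + m • j v) ↔
    SCDPoint (closedBall (0 : E) 1) u ∧ SCDPoint (closedBall (0 : F) 1) v := by
  have hz' : ∀ z, j (q z) + i (p z) = z := fun z => by rw [add_comm, hz]
  have hn' : ∀ z, ‖z‖ = ‖q z‖ + ‖p z‖ := fun z => by rw [add_comm, hn]
  constructor
  · intro h
    refine ⟨scd_proj i j p q hpi hqi hpj hqj hz hn hu hv hl hm hlm h, ?_⟩
    rw [add_comm] at h
    exact scd_proj j i q p hqj hpj hqi hpi hz' hn' hv hu hm hl (by linarith) h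
  · rintro ⟨h1, h2⟩
    exact scd_convex (convex_closedBall _ _) (scd_incl i j p q hpi hqi hz hn hu h1)
      (scd_incl j i q p hqj hpj hz' hn' hv h2) hl.le hm.le hlm

end helpers

/-- for `(a,b) ∈ S_{X ⊕_1 Y}` with `a ≠ 0 ≠ b`, the point `(a,b)` is an SCD
point of the unit ball of `X ⊕_1 Y` iff `a/‖a‖` is an SCD point of `B_X` and `b/‖b‖` is an
SCD point of `B_Y`. -/
theorem stmt13 {X Y : Type*} [NormedAddCommGroup X] [NormedSpace ℝ X] [CompleteSpace X]
    [NormedAddCommGroup Y] [NormedSpace ℝ Y] [CompleteSpace Y]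
    (a : X) (b : Y) (ha : a ≠ 0) (hb : b ≠ 0) (hnorm : ‖a‖ + ‖b‖ = 1) :
    SCDPoint (Metric.closedBall (0 : WithLp 1 (X × Y)) 1)
        ((WithLp.equiv 1 (X × Y)).symm (a, b)) ↔
      SCDPoint (Metric.closedBall (0 : X) 1) (‖a‖⁻¹ • a) ∧
      SCDPoint (Metric.closedBall (0 : Y) 1) (‖b‖⁻¹ • b) := by
  have ha' : 0 < ‖a‖ := norm_pos_iff.2 ha
  have hb' : 0 < ‖b‖ := norm_pos_iff.2 hb
  let e := WithLp.prodContinuousLinearEquiv 1 ℝ X Y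
  have key := scd_iff (Z := WithLp 1 (X × Y)) (E := X) (F := Y)
    ((e.symm : (X × Y) →L[ℝ] WithLp 1 (X × Y)).comp (ContinuousLinearMap.inl ℝ X Y))
    ((e.symm : (X × Y) →L[ℝ] WithLp 1 (X × Y)).comp (ContinuousLinearMap.inr ℝ X Y))
    ((ContinuousLinearMap.fst ℝ X Y).comp (e : WithLp 1 (X × Y) →L[ℝ] (X × Y)))
    ((ContinuousLinearMap.snd ℝ X Y).comp (e : WithLp 1 (X × Y) →L[ℝ] (X × Y)))
    (by intro x; simp) (by intro x; simp) (by intro x; simp) (by intro x; simp)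
    (by
      intro z
      apply e.injective
      simp)
    (by
      intro z
      rw [WithLp.prod_norm_eq_of_L1]
      rfl)
    (u := ‖a‖⁻¹ • a) (v := ‖b‖⁻¹ • b) (by simp [norm_smul, ha'.ne']) (by simp [norm_smul, hb'.ne'])
    ha' hb' hnorm
  rw [← key]
  have : (WithLp.equiv 1 (X × Y)).symm (a, b) =
    ‖a‖ • ((e.symm : (X × Y) →L[ℝ] WithLp 1 (X × Y)).comp (ContinuousLinearMap.inl ℝ X Y))
      (‖a‖⁻¹ • a) +
    ‖b‖ • ((e.symm : (X × Y) →L[ℝ] WithLp 1 (X × Y)).comp (ContinuousLinearMap.inr ℝ X Y))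
      (‖b‖⁻¹ • b) := by
    rw [map_smul, map_smul, smul_inv_smul₀ ha'.ne', smul_inv_smul₀ hb'.ne']
    apply e.injective
    rw [map_add]
    simp
    rfl
  rw [this]
end

section
/- Let X be a real Banach space with the Daugavet property and let Y be a closed subspace of X. Assume that in the quotient space X/Y, the point 0 is an SCD point of every convex subset C ⊆ B_{X/Y} that contains 0. Then Y has the Daugavet property. -/
open Set Metric

variable {X : Type*} [NormedAddCommGroup X] [NormedSpace ℝ X]

/-- `X` has the Daugavet property: every rank-one bounded linear operator `T : X → X`
satisfies `‖Id + T‖ = 1 + ‖T‖`. -/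
def DaugavetProperty (X : Type*) [NormedAddCommGroup X] [NormedSpace ℝ X] : Prop :=
  ∀ T : X →L[ℝ] X, (∃ (f : X →L[ℝ] ℝ) (y : X), f ≠ 0 ∧ y ≠ 0 ∧ T = f.smulRight y) →
    ‖ContinuousLinearMap.id ℝ X + T‖ = 1 + ‖T‖

theorem aux_compact_hull {E : Type*} [NormedAddCommGroup E] [NormedSpace ℝ E]
    [FiniteDimensional ℝ E] {s : Set E} (hs : IsCompact s) : IsCompact (convexHull ℝ s) := by
  have key : convexHull ℝ s = ⋃ k ∈ Set.Iic (Module.finrank ℝ E + 1),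
      (fun p : (Fin k → ℝ) × (Fin k → E) => ∑ i, p.1 i • p.2 i) ''
        (stdSimplex ℝ (Fin k) ×ˢ Set.pi Set.univ (fun _ => s)) := by
    apply Set.Subset.antisymm
    · intro x hx
      rw [convexHull_eq_union] at hx
      simp only [Set.mem_iUnion] at hx
      obtain ⟨t, hts, hind, hxt⟩ := hx
      rw [Finset.mem_convexHull'] at hxt
      obtain ⟨w, hw0, hw1, hwx⟩ := hxt
      have hcard : t.card ≤ Module.finrank ℝ E + 1 := by
        have := hind.card_le_finrank_succ
        rw [Fintype.card_coe] at this
        exact this.trans (Nat.succ_le_succ (Submodule.finrank_le _))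
      simp only [Set.mem_iUnion]
      refine ⟨t.card, hcard, (fun i => w (t.equivFin.symm i), fun i => (t.equivFin.symm i : E)),
        ⟨⟨fun i => hw0 _ (t.equivFin.symm i).2, ?_⟩, fun i _ => hts (t.equivFin.symm i).2⟩, ?_⟩
      · rw [Equiv.sum_comp t.equivFin.symm (fun y : t => w y), Finset.sum_coe_sort]
        exact hw1
      · show ∑ i, w (t.equivFin.symm i) • (t.equivFin.symm i : E) = x
        rw [Equiv.sum_comp t.equivFin.symm (fun y : t => w y • (y : E)),
          Finset.sum_coe_sort t (fun y => w y • y)]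
        exact hwx
    · intro x hx
      simp only [Set.mem_iUnion] at hx
      obtain ⟨k, -, p, ⟨⟨hp0, hp1⟩, hp2⟩, rfl⟩ := hx
      exact (convex_convexHull ℝ s).sum_mem (fun i _ => hp0 i) hp1
        (fun i _ => subset_convexHull ℝ s (hp2 i (Set.mem_univ _)))
  rw [key]
  refine (Set.finite_Iic _).isCompact_biUnion fun k _ => ?_
  refine IsCompact.image ((isCompact_stdSimplex ℝ (Fin k)).prod (isCompact_univ_pi fun _ => hs)) ?_
  fun_prop

theorem aux_milman {E : Type*} [NormedAddCommGroup E] [NormedSpace ℝ E]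
    [FiniteDimensional ℝ E] {s K : Set E} (hsb : Bornology.IsBounded s)
    (hK : K = closure (convexHull ℝ s)) {p : E} (hp : p ∈ K.extremePoints ℝ) : p ∈ closure s := by
  have hc : IsCompact (closure s) := hsb.isCompact_closure
  have h1 : K = convexHull ℝ (closure s) := by
    rw [hK]
    apply Set.Subset.antisymm
    · exact closure_minimal (convexHull_mono subset_closure) (aux_compact_hull hc).isClosed
    · exact convexHull_min (closure_mono (subset_convexHull ℝ s)) (convex_convexHull ℝ s).closure
  rw [h1] at hp
  exact extremePoints_convexHull_subset hp

/-- slices of the ball in a Daugavet space contain almost orthogonal points -/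
theorem aux_slice {X : Type*} [NormedAddCommGroup X] [NormedSpace ℝ X] (hX : DaugavetProperty X)
    (f : X →L[ℝ] ℝ) (s : X) (hs : s ≠ 0) (η α : ℝ) (hη : 0 < η) (hα : 0 < α) :
    ∃ x, ‖x‖ ≤ 1 ∧ ‖f‖ - α < f x ∧ ‖s‖ + 1 - η < ‖s + x‖ := by
  have hs' : 0 < ‖s‖ := norm_pos_iff.mpr hs
  by_cases hf : f = 0
  · subst hf
    refine ⟨(‖s‖⁻¹ : ℝ) • s, ?_, by simpa using hα, ?_⟩
    · rw [norm_smul, norm_inv, norm_norm, inv_mul_cancel₀ hs'.ne']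
    · have : s + (‖s‖⁻¹ : ℝ) • s = (1 + ‖s‖⁻¹ : ℝ) • s := by rw [add_smul, one_smul]
      rw [this, norm_smul, Real.norm_of_nonneg (by positivity), add_mul, inv_mul_cancel₀ hs'.ne']
      linarith
  have hf' : 0 < ‖f‖ := norm_pos_iff.mpr hf
  have hc : 0 < ‖f‖⁻¹ := inv_pos.mpr hf'
  set u : X := (‖f‖⁻¹ : ℝ) • s with hu
  have hu0 : u ≠ 0 := smul_ne_zero hc.ne' hs
  have hnu : ‖u‖ = ‖f‖⁻¹ * ‖s‖ := by rw [hu, norm_smul, Real.norm_of_nonneg hc.le]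
  have hT := hX (f.smulRight u) ⟨f, u, hf, hu0, rfl⟩
  have hfu : ‖f‖ * ‖u‖ = ‖s‖ := by rw [hnu]; field_simp
  rw [ContinuousLinearMap.norm_smulRight_apply, hfu] at hT
  obtain ⟨ε, hε, hε1, hε2⟩ : ∃ ε : ℝ, 0 < ε ∧ 2 * ε ≤ η ∧ ε ≤ α * ‖u‖ := by
    have : 0 < α * ‖u‖ := mul_pos hα (norm_pos_iff.mpr hu0)
    exact ⟨min (η / 2) (α * ‖u‖), lt_min (by linarith) this, by
      linarith [min_le_left (η / 2) (α * ‖u‖)], min_le_right _ _⟩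
  obtain ⟨x, hx1, hx2⟩ := ContinuousLinearMap.exists_lt_apply_of_lt_opNorm
    (ContinuousLinearMap.id ℝ X + f.smulRight u) (r := 1 + ‖s‖ - ε) (by rw [hT]; linarith)
  have main : ∀ x : X, ‖x‖ < 1 → 1 + ‖s‖ - ε < ‖x + f x • u‖ → 0 ≤ f x →
      ∃ x, ‖x‖ ≤ 1 ∧ ‖f‖ - α < f x ∧ ‖s‖ + 1 - η < ‖s + x‖ := by
    intro x hx1 hx2 hfx
    have hle : f x ≤ ‖f‖ := by
      have := f.le_opNorm x
      rw [Real.norm_of_nonneg hfx] at this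
      nlinarith
    have h1 : ‖x + f x • u‖ ≤ ‖x‖ + f x * ‖u‖ := by
      refine (norm_add_le _ _).trans ?_
      rw [norm_smul, Real.norm_of_nonneg hfx]
    have hup : 0 < ‖u‖ := norm_pos_iff.mpr hu0
    have h2 : (‖f‖ - f x) * ‖u‖ < ε := by nlinarith
    refine ⟨x, hx1.le, ?_, ?_⟩
    · have : (‖f‖ - f x) * ‖u‖ < α * ‖u‖ := h2.trans_le hε2
      have := lt_of_mul_lt_mul_right this hup.le
      linarith
    · have hsu : s = ‖f‖ • u := by rw [hu, smul_smul, mul_inv_cancel₀ hf'.ne', one_smul]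
      have e : x + f x • u = (s + x) - (‖f‖ - f x) • u := by
        rw [sub_smul, ← hsu]; abel
      have h3 : ‖x + f x • u‖ ≤ ‖s + x‖ + (‖f‖ - f x) * ‖u‖ := by
        rw [e]
        refine (norm_sub_le _ _).trans ?_
        rw [norm_smul, Real.norm_of_nonneg (by linarith : 0 ≤ ‖f‖ - f x)]
      linarith
  have hx2' : 1 + ‖s‖ - ε < ‖x + f x • u‖ := by simpa using hx2
  rcases le_total 0 (f x) with h | h
  · exact main x hx1 hx2' h
  · refine main (-x) (by rwa [norm_neg]) ?_ (by rw [map_neg]; linarith)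
    have : -x + f (-x) • u = -(x + f x • u) := by rw [map_neg, neg_smul, neg_add]
    rwa [this, norm_neg]

/-- converse -/
theorem aux_converse {Y : Type*} [NormedAddCommGroup Y] [NormedSpace ℝ Y]
    (h : ∀ (f : Y →L[ℝ] ℝ) (s : Y), s ≠ 0 → ∀ η : ℝ, 0 < η →
      ∃ x, ‖x‖ ≤ 1 ∧ ‖f‖ - η ≤ f x ∧ ‖s‖ + 1 - η ≤ ‖s + x‖) : DaugavetProperty Y := by
  rintro T ⟨f, y, hf, hy, rfl⟩
  have hf' : 0 < ‖f‖ := norm_pos_iff.mpr hf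
  apply le_antisymm
  · exact (norm_add_le _ _).trans (add_le_add_left ContinuousLinearMap.norm_id_le _)
  · rw [ContinuousLinearMap.norm_smulRight_apply]
    apply le_of_forall_pos_sub_le
    intro ε hε
    obtain ⟨x, hx1, hx2, hx3⟩ := h f (‖f‖ • y) (smul_ne_zero hf'.ne' hy) (ε / (1 + ‖y‖))
      (by positivity)
    rw [norm_smul, norm_norm] at hx3
    have hle : f x ≤ ‖f‖ := by
      have := (le_abs_self _).trans (f.le_opNorm x)
      nlinarith
    have e : ‖f‖ • y + x = (x + f x • y) + (‖f‖ - f x) • y := by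
      rw [sub_smul]; abel
    have h3 : ‖‖f‖ • y + x‖ ≤ ‖x + f x • y‖ + (‖f‖ - f x) * ‖y‖ := by
      rw [e]
      refine (norm_add_le _ _).trans ?_
      rw [norm_smul, Real.norm_of_nonneg (by linarith : 0 ≤ ‖f‖ - f x)]
    have h4 : ‖x + f x • y‖ ≤ ‖ContinuousLinearMap.id ℝ Y + f.smulRight y‖ := by
      have := (ContinuousLinearMap.id ℝ Y + f.smulRight y).unit_le_opNorm x hx1
      simpa using this
    have h5 : ε / (1 + ‖y‖) * (1 + ‖y‖) = ε := by
      have := norm_nonneg y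
      field_simp
    have h6 : (‖f‖ - f x) * ‖y‖ ≤ ε / (1 + ‖y‖) * ‖y‖ :=
      mul_le_mul_of_nonneg_right (by linarith) (norm_nonneg _)
    nlinarith

/-- sets in which one finds points almost orthogonal to any given nonzero vector -/
def AuxGood {X : Type*} [NormedAddCommGroup X] [NormedSpace ℝ X] (A : Set X) : Prop :=
  ∀ s : X, s ≠ 0 → ∀ η : ℝ, 0 < η → ∃ x ∈ A, ‖s‖ + 1 - η < ‖s + x‖

theorem aux_seq {X : Type*} [NormedAddCommGroup X] [NormedSpace ℝ X] (A : ℕ → Set X)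
    (hA : ∀ n, AuxGood (A n)) (hA1 : ∀ n, ∀ x ∈ A n, ‖x‖ ≤ 1) (s : X) (hs : s ≠ 0) (η : ℝ)
    (hη : 0 < η) : ∃ x : ℕ → X, (∀ n, x n ∈ A n) ∧
      ∀ z ∈ convexHull ℝ (range x), ‖s‖ + 1 - η ≤ ‖s + z‖ := by
  have hs' : 0 < ‖s‖ := norm_pos_iff.mpr hs
  -- reduce η so that the partial sums stay nonzero
  obtain ⟨η', hη', hη1, hη2⟩ : ∃ η' : ℝ, 0 < η' ∧ η' ≤ η ∧ η' ≤ ‖s‖ :=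
    ⟨min η ‖s‖, lt_min hη hs', min_le_left _ _, min_le_right _ _⟩
  have step : ∀ (n : ℕ) (t : X), ‖s‖ + n - η' < ‖t‖ →
      ∃ x ∈ A n, ‖s‖ + (n + 1 : ℕ) - η' < ‖t + x‖ := by
    intro n t ht
    have hn : (0 : ℝ) ≤ n := Nat.cast_nonneg n
    have ht0 : t ≠ 0 := by
      rw [← norm_pos_iff]; linarith
    obtain ⟨x, hx, hx'⟩ := hA n t ht0 (‖t‖ - (‖s‖ + n - η')) (by linarith)
    refine ⟨x, hx, ?_⟩
    push_cast
    linarith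
  choose! g hg1 hg2 using step
  let t : ℕ → X := fun n => Nat.rec s (fun n t => t + g n t) n
  have ht0 : t 0 = s := rfl
  have htS : ∀ n, t (n + 1) = t n + g n (t n) := fun n => rfl
  have ht : ∀ n : ℕ, ‖s‖ + n - η' < ‖t n‖ := by
    intro n
    induction n with
    | zero => rw [ht0]; push_cast; linarith
    | succ n ih => rw [htS]; exact hg2 n _ ih
  let x : ℕ → X := fun n => g n (t n)
  have hxA : ∀ n, x n ∈ A n := fun n => hg1 n _ (ht n)
  have hsum : ∀ n, t n = s + ∑ i ∈ Finset.range n, x i := by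
    intro n
    induction n with
    | zero => simp [ht0]
    | succ n ih => rw [htS, Finset.sum_range_succ, ← add_assoc, ← ih]
  refine ⟨x, hxA, ?_⟩
  intro z hz
  have hdir : Directed (· ⊆ ·) (fun n : ℕ => convexHull ℝ (x '' Set.Iio n)) := by
    apply Monotone.directed_le
    intro a b hab
    exact convexHull_mono (Set.image_mono (Set.Iio_subset_Iio hab))
  have hU : z ∈ ⋃ n : ℕ, convexHull ℝ (x '' Set.Iio n) := by
    refine convexHull_min ?_ (hdir.convex_iUnion fun {n} => convex_convexHull ℝ _) hz
    rintro _ ⟨n, rfl⟩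
    exact Set.mem_iUnion.mpr ⟨n + 1, subset_convexHull ℝ _ ⟨n, Nat.lt_succ_self n, rfl⟩⟩
  obtain ⟨N, hN⟩ := Set.mem_iUnion.mp hU
  obtain ⟨f, hf1, hf2⟩ := exists_dual_vector'' ℝ (t N)
  have hfle : ∀ v : X, f v ≤ ‖v‖ := fun v => by
    have := (le_abs_self _).trans (f.le_opNorm v)
    nlinarith [norm_nonneg v]
  have hf2' : f (t N) = ‖t N‖ := by simpa using hf2
  have hhalf : z ∈ {w : X | ‖s‖ + 1 - η' - f s ≤ f w} := by
    refine convexHull_min ?_ (convex_halfSpace_ge f.toLinearMap.isLinear _) hN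
    rintro _ ⟨i, hi, rfl⟩
    have h1 := ht N
    rw [← hf2', hsum, map_add, map_sum,
      ← Finset.add_sum_erase _ _ (Finset.mem_range.mpr hi)] at h1
    have h2 : ∑ j ∈ (Finset.range N).erase i, f (x j) ≤ ((Finset.range N).erase i).card • (1:ℝ) :=
      Finset.sum_le_card_nsmul _ _ _ fun j _ => (hfle _).trans (hA1 j _ (hxA j))
    rw [Finset.card_erase_of_mem (Finset.mem_range.mpr hi), Finset.card_range, nsmul_eq_mul,
      mul_one, Nat.cast_sub (by have : i < N := hi; omega)] at h2
    push_cast at h2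
    show ‖s‖ + 1 - η' - f s ≤ f (x i)
    linarith
  have h3 : ‖s‖ + 1 - η' - f s ≤ f z := hhalf
  have h4 := hfle (s + z)
  rw [map_add] at h4
  linarith

/-- relatively weakly open subsets of the ball (given by two functionals) are good -/
theorem aux_weak {X : Type*} [NormedAddCommGroup X] [NormedSpace ℝ X] (hX : DaugavetProperty X)
    (P : X →L[ℝ] ℝ × ℝ) (U : Set (ℝ × ℝ)) (hU : IsOpen U)
    (hne : ∃ x : X, ‖x‖ ≤ 1 ∧ P x ∈ U) : AuxGood {x : X | ‖x‖ ≤ 1 ∧ P x ∈ U} := by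
  obtain ⟨x0, hx0, hx0U⟩ := hne
  set K : Set (ℝ × ℝ) := closure (P '' closedBall 0 1) with hKdef
  have hPb : Bornology.IsBounded (P '' closedBall 0 1) :=
    P.lipschitz.isBounded_image isBounded_closedBall
  have hKc : IsCompact K := hPb.isCompact_closure
  have hPconv : Convex ℝ (P '' closedBall 0 1) :=
    (convex_closedBall (0 : X) 1).linear_image P.toLinearMap
  have hKconv : Convex ℝ K := hPconv.closure
  -- each neighbourhood of an extreme point gives a good set
  have hext : ∀ p ∈ K.extremePoints ℝ, ∀ δ : ℝ, 0 < δ →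
      AuxGood {x : X | ‖x‖ ≤ 1 ∧ ‖P x - p‖ < δ} := by
    intro p hp δ hδ s hs η hη
    set D : Set X := {x | ‖x‖ ≤ 1 ∧ ‖s‖ + 1 - η < ‖s + x‖} with hD
    have hDB : P '' D ⊆ P '' closedBall 0 1 :=
      Set.image_mono fun x hx => by simpa using hx.1
    have hKD : K = closure (convexHull ℝ (P '' D)) := by
      apply Set.Subset.antisymm
      · refine closure_minimal ?_ isClosed_closure
        rintro _ ⟨x, hx, rfl⟩
        by_contra hcon
        obtain ⟨φ, u, h1, h2⟩ := geometric_hahn_banach_closed_point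
          (convex_convexHull ℝ (P '' D)).closure isClosed_closure hcon
        obtain ⟨y, hy1, hy2, hy3⟩ := aux_slice hX (φ.comp P) s hs η (φ (P x) - u) hη
          (by linarith)
        have h3 := h1 (P y) (subset_closure (subset_convexHull ℝ _ ⟨y, ⟨hy1, hy3⟩, rfl⟩))
        have h4 : φ (P x) ≤ ‖φ.comp P‖ := by
          have := (le_abs_self _).trans ((φ.comp P).unit_le_opNorm x (by simpa using hx))
          simpa using this
        have h5 : (φ.comp P) y = φ (P y) := rfl
        linarith
      · exact closure_mono (convexHull_min hDB hPconv)
    have := aux_milman (hPb.subset hDB) hKD hp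
    obtain ⟨_, ⟨x, hx, rfl⟩, hlt⟩ := Metric.mem_closure_iff.mp this δ hδ
    refine ⟨x, ⟨hx.1, ?_⟩, hx.2⟩
    rwa [dist_comm, dist_eq_norm] at hlt
  intro s hs η hη
  have hx0K : P x0 ∈ K := subset_closure ⟨x0, by simpa using hx0, rfl⟩
  rw [← closure_convexHull_extremePoints hKc hKconv] at hx0K
  obtain ⟨c, hcU, hc⟩ := mem_closure_iff.mp hx0K U hU hx0U
  obtain ⟨δ, hδ, hball⟩ := Metric.isOpen_iff.mp hU c hcU
  rw [convexHull_eq_union_convexHull_finite_subsets] at hc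
  simp only [Set.mem_iUnion] at hc
  obtain ⟨t, htK, hct⟩ := hc
  have htne : (t : Set (ℝ × ℝ)).Nonempty := convexHull_nonempty_iff.mp ⟨c, hct⟩
  obtain ⟨p, hp⟩ := (t.countable_toSet).exists_eq_range htne
  obtain ⟨x, hxA, hx⟩ := aux_seq (fun n => {x : X | ‖x‖ ≤ 1 ∧ ‖P x - p n‖ < δ})
    (fun n => hext (p n) (htK (by rw [hp]; exact ⟨n, rfl⟩)) δ hδ) (fun n x hx => hx.1) s hs (η / 2)
    (by linarith)
  rw [hp] at hct
  have himg : range p = (LinearMap.snd ℝ X (ℝ × ℝ)) '' range (fun n => (x n, p n)) := by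
    rw [← Set.range_comp]; rfl
  rw [himg, ← LinearMap.image_convexHull] at hct
  obtain ⟨⟨z, c'⟩, hz, hzc⟩ := hct
  have hzc' : c' = c := hzc
  subst hzc'
  have hzx : z ∈ convexHull ℝ (range x) := by
    have himg2 : range x = (LinearMap.fst ℝ X (ℝ × ℝ)) '' range (fun n => (x n, p n)) := by
      rw [← Set.range_comp]; rfl
    rw [himg2, ← LinearMap.image_convexHull]
    exact ⟨_, hz, rfl⟩
  have hz1 : z ∈ closedBall (0 : X) 1 := by
    refine convexHull_min ?_ (convex_closedBall _ _) hzx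
    rintro _ ⟨n, rfl⟩
    simpa using (hxA n).1
  have hzP : ((z, c') : X × (ℝ × ℝ)) ∈
      (P.toLinearMap.comp (LinearMap.fst ℝ X (ℝ × ℝ)) - LinearMap.snd ℝ X (ℝ × ℝ)) ⁻¹'
        ball 0 δ := by
    refine convexHull_min ?_ ((convex_ball _ _).linear_preimage _) hz
    rintro _ ⟨n, rfl⟩
    simpa using (hxA n).2
  refine ⟨z, ⟨by simpa using hz1, hball ?_⟩, ?_⟩
  · rw [mem_ball, dist_eq_norm]
    simpa using hzP
  · have := hx z hzx
    linarith

/-- if `X` has the Daugavet property and `0` is an SCD point of every convex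
subset of the unit ball of `X ⧸ Y` containing it, then the closed subspace `Y` has the
Daugavet property. -/
theorem stmt17 {X : Type*} [NormedAddCommGroup X] [NormedSpace ℝ X] [CompleteSpace X]
    (Y : Submodule ℝ X) [IsClosed (Y : Set X)]
    (hX : DaugavetProperty X)
    (h0 : ∀ C : Set (X ⧸ Y), C ⊆ Metric.closedBall 0 1 → Convex ℝ C → (0 : X ⧸ Y) ∈ C →
      SCDPoint C 0) :
    DaugavetProperty Y := by
  apply aux_converse
  intro f y0 hy0 η hη
  obtain ⟨g, hgf, hgn⟩ := exists_extension_norm_eq Y f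
  have hy0' : (y0 : X) ≠ 0 := by simpa using hy0
  set a : ℝ := ‖f‖ - η / 2 with ha
  set S : Set X := {x | ‖x‖ ≤ 1 ∧ a < g x} with hS
  have hSconv : Convex ℝ S := by
    have h1 : S = closedBall 0 1 ∩ {x | a < g x} := by
      ext x; simp [hS]
    rw [h1]
    exact (convex_closedBall _ _).inter (convex_halfSpace_gt g.toLinearMap.isLinear _)
  set q : X →ₗ[ℝ] X ⧸ Y := Y.mkQ with hq
  have hqle : ∀ x, ‖q x‖ ≤ ‖x‖ := fun x => Submodule.Quotient.norm_mk_le Y x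
  let qc : X →L[ℝ] X ⧸ Y := q.mkContinuous 1 (fun x => by rw [one_mul]; exact hqle x)
  have hqc : ∀ x, qc x = q x := fun x => rfl
  have h0C : (0 : X ⧸ Y) ∈ q '' S := by
    have : ∃ y : Y, ‖y‖ ≤ 1 ∧ a < f y := by
      by_cases hf : f = 0
      · exact ⟨0, by simp, by rw [ha, hf]; simp; linarith⟩
      have hf' : 0 < ‖f‖ := norm_pos_iff.mpr hf
      obtain ⟨y, hy1, hy2⟩ := f.exists_lt_apply_of_lt_opNorm (r := a) (by linarith)
      rcases le_total 0 (f y) with h | h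
      · exact ⟨y, hy1.le, by rwa [Real.norm_of_nonneg h] at hy2⟩
      · exact ⟨-y, by rw [norm_neg]; exact hy1.le, by
          rw [Real.norm_of_nonpos h] at hy2; rwa [map_neg]⟩
    obtain ⟨y, hy1, hy2⟩ := this
    refine ⟨y, ⟨hy1, by rw [hgf]; exact hy2⟩, ?_⟩
    rw [hq, Submodule.mkQ_apply, Submodule.Quotient.mk_eq_zero]
    exact y.2
  obtain ⟨-, V, hV, hdet⟩ := h0 (q '' S) (by
    rintro _ ⟨x, hx, rfl⟩
    rw [mem_closedBall_zero_iff]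
    exact (hqle x).trans hx.1) (hSconv.linear_image q) h0C
  have hgood : ∀ n, AuxGood {x : X | x ∈ S ∧ q x ∈ V n} := by
    intro n
    obtain ⟨⟨v, hv⟩, φ, α, hα, hVn⟩ := hV n
    set b := sSup (φ '' (q '' S)) - α with hb
    have hset : {x : X | x ∈ S ∧ q x ∈ V n} =
        {x : X | ‖x‖ ≤ 1 ∧ (g.prod (φ.comp qc)) x ∈ Set.Ioi a ×ˢ Set.Ioi b} := by
      ext x
      constructor
      · rintro ⟨hx, hxV⟩
        rw [hVn] at hxV
        exact ⟨hx.1, hx.2, hxV.2⟩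
      · rintro ⟨h1, h2, h3⟩
        refine ⟨⟨h1, h2⟩, ?_⟩
        rw [hVn]
        exact ⟨⟨x, ⟨h1, h2⟩, rfl⟩, h3⟩
    have hne : {x : X | x ∈ S ∧ q x ∈ V n}.Nonempty := by
      have hv' := hv
      rw [hVn] at hv'
      obtain ⟨⟨x, hx, rfl⟩, -⟩ := hv'
      exact ⟨x, hx, hv⟩
    rw [hset] at hne ⊢
    exact aux_weak hX _ _ (isOpen_Ioi.prod isOpen_Ioi) hne
  obtain ⟨x, hxA, hx⟩ := aux_seq _ hgood (fun n x hx => hx.1.1) (y0 : X) hy0' (η / 2)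
    (by linarith)
  have hcl := hdet (q '' range x) (by
    rintro _ ⟨_, ⟨n, rfl⟩, rfl⟩
    exact ⟨x n, (hxA n).1, rfl⟩) (fun n => ⟨q (x n), ⟨x n, ⟨n, rfl⟩, rfl⟩, (hxA n).2⟩)
  rw [← LinearMap.image_convexHull] at hcl
  obtain ⟨δ, hδ, hδ1, hδ2⟩ : ∃ δ : ℝ, 0 < δ ∧ 2 * δ ≤ η / 2 ∧ 2 * δ * ‖g‖ ≤ η / 2 := by
    refine ⟨η / (4 * (1 + ‖g‖)), by positivity, ?_, ?_⟩
    · have : η / (4 * (1 + ‖g‖)) ≤ η / 4 := by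
        apply div_le_div_of_nonneg_left hη.le (by norm_num)
        nlinarith [norm_nonneg g]
      linarith
    · have h1 : η / (4 * (1 + ‖g‖)) * (4 * (1 + ‖g‖)) = η := by
        have := norm_nonneg g
        field_simp
      have h2 : 0 < η / (4 * (1 + ‖g‖)) := by positivity
      nlinarith
  obtain ⟨_, ⟨z, hz, rfl⟩, hzd⟩ := Metric.mem_closure_iff.mp hcl δ hδ
  rw [dist_comm, dist_zero_right] at hzd
  have hzS : z ∈ S := convexHull_min (by rintro _ ⟨n, rfl⟩; exact (hxA n).1) hSconv hz
  obtain ⟨m, hm1, hm2⟩ := Submodule.Quotient.norm_mk_lt (q z) (sub_pos.mpr hzd)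
  have hmy : z - m ∈ Y := by
    rw [← Submodule.Quotient.eq]; exact hm1.symm
  have hm3 : ‖m‖ < δ := by linarith
  set y : Y := ⟨z - m, hmy⟩ with hy
  have hyn : ‖y‖ ≤ 1 + δ := by
    have : ‖z - m‖ ≤ ‖z‖ + ‖m‖ := norm_sub_le _ _
    show ‖z - m‖ ≤ _
    linarith [hzS.1]
  set y' : Y := ((1 + δ)⁻¹ : ℝ) • y with hy'
  have h1δ : 0 < 1 + δ := by linarith
  have hy'n : ‖y'‖ ≤ 1 := by
    rw [hy', norm_smul, norm_inv, Real.norm_of_nonneg h1δ.le, inv_mul_le_iff₀ h1δ]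
    linarith
  have hyy : y = (1 + δ) • y' := by
    rw [hy', smul_smul, mul_inv_cancel₀ h1δ.ne', one_smul]
  have hzy : z - (y' : X) = m + δ • (y' : X) := by
    have h1 : (y : X) = z - m := rfl
    have h2 : z = m + (y : X) := by rw [h1]; abel
    rw [h2, hyy, Submodule.coe_smul, add_smul, one_smul]; abel
  have hdist : ‖z - (y' : X)‖ ≤ 2 * δ := by
    rw [hzy]
    refine (norm_add_le _ _).trans ?_
    rw [norm_smul, Real.norm_of_nonneg hδ.le]
    have : ‖(y' : X)‖ ≤ 1 := hy'n
    nlinarith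
  refine ⟨y', hy'n, ?_, ?_⟩
  · have h1 : g z - g y' ≤ ‖g‖ * (2 * δ) := by
      rw [← map_sub]
      exact (le_abs_self _).trans ((g.le_opNorm _).trans
        (mul_le_mul_of_nonneg_left hdist (norm_nonneg _)))
    rw [← hgf]
    have := hzS.2
    nlinarith
  · have h1 := hx z hz
    have h2 : ‖(y0 : X) + z‖ ≤ ‖(y0 : X) + y'‖ + ‖z - (y' : X)‖ := by
      have : (y0 : X) + z = ((y0 : X) + y') + (z - (y' : X)) := by abel
      rw [this]
      exact norm_add_le _ _
    have h3 : ‖y0 + y'‖ = ‖(y0 : X) + y'‖ := rfl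
    have h4 : ‖y0‖ = ‖(y0 : X)‖ := rfl
    rw [h3, h4]
    linarith
end

section
/- Let X be a real Banach space such that every convex series of slices of B_X intersects the unit sphere S_X. Then SCD(B_X) = ∅. If, moreover, X is separable, then X contains an isomorphic copy of ℓ_1 (there is a bounded linear injection from ℓ_1 into X that is bounded below). -/
open Set Metric

variable {X : Type*} [NormedAddCommGroup X] [NormedSpace ℝ X]

/-- `C` is a convex series of slices of `A`. -/
def IsConvexSeriesOfSlices {X : Type*} [NormedAddCommGroup X] [NormedSpace ℝ X]
    (A C : Set X) : Prop :=
  ∃ (S : ℕ → Set X) (l : ℕ → ℝ),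
    (∀ n, IsSlice A (S n)) ∧ (∀ n, 0 ≤ l n) ∧ (∑' n, l n) = 1 ∧ Summable l ∧
    C = {x | ∃ y : ℕ → X, (∀ n, y n ∈ S n) ∧ x = ∑' n, l n • y n}


section Aux

/-- almost norming vectors -/
lemma aux_norming (g : X →L[ℝ] ℝ) (e : ℝ) (he : 0 < e) :
    ∃ x ∈ closedBall (0 : X) 1, ‖g‖ - e < g x := by
  have h1 := ContinuousLinearMap.sSup_unitClosedBall_eq_norm g
  have h2 : ‖g‖ - e < sSup ((fun x => ‖g x‖) '' closedBall (0 : X) 1) := by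
    rw [h1]; linarith
  obtain ⟨_, ⟨x, hx, rfl⟩, hlt⟩ := exists_lt_of_lt_csSup
    ((nonempty_closedBall.2 zero_le_one).image _) h2
  simp only [Real.norm_eq_abs] at hlt
  rcases le_total 0 (g x) with h0 | h0
  · exact ⟨x, hx, by rwa [abs_of_nonneg h0] at hlt⟩
  · refine ⟨-x, by simpa using hx, ?_⟩
    rw [abs_of_nonpos h0] at hlt
    simpa using hlt

lemma aux_apply_le (g : X →L[ℝ] ℝ) {x : X} (hx : x ∈ closedBall (0 : X) 1) : g x ≤ ‖g‖ := by
  have h1 : ‖x‖ ≤ 1 := by simpa using hx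
  calc g x ≤ ‖g x‖ := le_abs_self _
    _ ≤ ‖g‖ * ‖x‖ := g.le_opNorm x
    _ ≤ ‖g‖ * 1 := by gcongr
    _ = ‖g‖ := mul_one _

lemma aux_sSup (g : X →L[ℝ] ℝ) : sSup (g '' closedBall (0 : X) 1) = ‖g‖ := by
  apply csSup_eq_of_forall_le_of_forall_lt_exists_gt
  · exact (nonempty_closedBall.2 zero_le_one).image _
  · rintro _ ⟨x, hx, rfl⟩
    exact aux_apply_le g hx
  · intro w hw
    obtain ⟨x, hx, h⟩ := aux_norming g (‖g‖ - w) (by linarith)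
    exact ⟨g x, ⟨x, hx, rfl⟩, by linarith⟩

lemma aux_slice_s18 (g : X →L[ℝ] ℝ) (e : ℝ) (he : 0 < e) :
    IsSlice (closedBall (0 : X) 1) {x | x ∈ closedBall (0 : X) 1 ∧ ‖g‖ - e < g x} := by
  refine ⟨?_, g, e, he, by rw [aux_sSup]⟩
  obtain ⟨x, hx, h⟩ := aux_norming g e he
  exact ⟨x, hx, h⟩

lemma aux_slice_neg {S : Set X} (hS : IsSlice (closedBall (0 : X) 1) S) :
    IsSlice (closedBall (0 : X) 1) {x | -x ∈ S} := by
  obtain ⟨⟨x, hx⟩, f, a, ha, rfl⟩ := hS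
  refine ⟨⟨-x, by simpa using hx⟩, -f, a, ha, ?_⟩
  ext y
  rw [aux_sSup, aux_sSup, norm_neg]
  simp

/-- the main consequence of the hypothesis: simultaneous norming -/
lemma aux_simul [CompleteSpace X]
    (h : ∀ C : Set X, IsConvexSeriesOfSlices (closedBall (0 : X) 1) C → ∃ x ∈ C, ‖x‖ = 1)
    {ι : Type*} [Countable ι] [Nonempty ι]
    (S : ι → Set X) (hS : ∀ n, IsSlice (closedBall (0 : X) 1) (S n)) :
    ∃ (y : ι → X) (f : X →L[ℝ] ℝ), ‖f‖ = 1 ∧ ∀ n, y n ∈ S n ∧ f (y n) = 1 := by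
  obtain ⟨e, he⟩ := exists_surjective_nat ι
  have hl : HasSum (fun n : ℕ => (1 : ℝ) / 2 / 2 ^ n) 1 := hasSum_geometric_two' 1
  obtain ⟨x, ⟨y, hy, rfl⟩, hx⟩ := h _ ⟨fun n => S (e n), fun n : ℕ => (1 : ℝ) / 2 / 2 ^ n,
    fun n => hS (e n), fun n => by positivity, hl.tsum_eq, hl.summable, rfl⟩
  replace hy : ∀ n, y n ∈ S (e n) := hy
  replace hx : ‖∑' n : ℕ, ((1 : ℝ) / 2 / 2 ^ n) • y n‖ = 1 := hx
  have hyB : ∀ n, y n ∈ closedBall (0 : X) 1 := by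
    intro n
    obtain ⟨_, f, a, _, h1⟩ := hS (e n)
    have := hy n
    rw [h1] at this
    exact this.1
  have hsum : Summable (fun n : ℕ => ((1 : ℝ) / 2 / 2 ^ n) • y n) := by
    refine Summable.of_norm_bounded hl.summable (fun n => ?_)
    rw [norm_smul, Real.norm_of_nonneg (by positivity)]
    have : ‖y n‖ ≤ 1 := by simpa using hyB n
    exact mul_le_of_le_one_right (by positivity) this
  obtain ⟨f, hf1, hf2⟩ := exists_dual_vector ℝ (∑' n : ℕ, ((1 : ℝ) / 2 / 2 ^ n) • y n)
    (by rw [hx]; exact one_ne_zero)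
  rw [hx] at hf2
  replace hf2 : f (∑' n : ℕ, ((1 : ℝ) / 2 / 2 ^ n) • y n) = 1 := hf2
  have hs2 := f.hasSum hsum.hasSum
  rw [hf2] at hs2
  have hs3 := hl.sub hs2
  have hle : ∀ n, f (y n) ≤ 1 := fun n => hf1 ▸ aux_apply_le f (hyB n)
  have hz := (hasSum_zero_iff_of_nonneg (f := fun n : ℕ => ((1 : ℝ) / 2 / 2 ^ n) * (1 - f (y n)))
    (fun n => mul_nonneg (by positivity) (by have := hle n; simpa using this))).1
    (by
      have e1 : (fun n : ℕ => ((1 : ℝ) / 2 / 2 ^ n) * (1 - f (y n))) =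
          fun n : ℕ => (1 : ℝ) / 2 / 2 ^ n - f (((1 : ℝ) / 2 / 2 ^ n) • y n) := by
        funext n; rw [map_smul, smul_eq_mul]; ring
      rw [e1]
      rw [sub_self] at hs3
      exact hs3)
  have hone : ∀ n, f (y n) = 1 := by
    intro n
    have := congrFun hz n
    simp only [Pi.zero_apply, mul_eq_zero] at this
    rcases this with h0 | h0
    · exact absurd h0 (by positivity)
    · linarith
  choose r hr using he
  refine ⟨fun i => y (r i), f, hf1, fun i => ⟨?_, hone _⟩⟩
  have := hy (r i)
  rwa [hr] at this

lemma aux_noSCD [CompleteSpace X]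
    (h : ∀ C : Set X, IsConvexSeriesOfSlices (closedBall (0 : X) 1) C → ∃ x ∈ C, ‖x‖ = 1) :
    {a | SCDPoint (closedBall (0 : X) 1) a} = ∅ := by
  rw [eq_empty_iff_forall_notMem]
  rintro a ⟨-, V, hV, hdet⟩
  obtain ⟨y, f, -, hy⟩ := aux_simul h
    (fun p : ℕ × Bool => if p.2 then V p.1 else {x | -x ∈ V p.1}) (by
      rintro ⟨n, b⟩
      cases b
      · simpa using aux_slice_neg (hV n)
      · simpa using hV n)
  have hVB : ∀ n, V n ⊆ closedBall (0 : X) 1 := by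
    intro n x hx
    obtain ⟨_, f, a, _, h1⟩ := hV n
    rw [h1] at hx
    exact hx.1
  have key : ∀ (z : ℕ → X) (c : ℝ), (∀ n, z n ∈ V n) → (∀ n, f (z n) = c) → f a = c := by
    intro z c hz hc
    have h1 := hdet (range z) (by rintro _ ⟨n, rfl⟩; exact hVB n (hz n))
      (fun n => ⟨z n, ⟨n, rfl⟩, hz n⟩)
    have h2 : closure (convexHull ℝ (range z)) ⊆ {x | f x = c} := by
      apply closure_minimal
      · apply convexHull_min
        · rintro _ ⟨n, rfl⟩; exact hc n
        · exact convex_hyperplane f.toLinearMap.isLinear c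
      · exact isClosed_eq f.continuous continuous_const
    exact h2 h1
  have k1 := key (fun n => y (n, true)) 1 (fun n => by simpa using (hy (n, true)).1)
    (fun n => (hy (n, true)).2)
  have k2 := key (fun n => - y (n, false)) (-1) (fun n => by simpa using (hy (n, false)).1)
    (fun n => by rw [map_neg, (hy (n, false)).2])
  linarith

lemma aux_ext [CompleteSpace X]
    (h : ∀ C : Set X, IsConvexSeriesOfSlices (closedBall (0 : X) 1) C → ∃ x ∈ C, ‖x‖ = 1)
    (C : Set (X →L[ℝ] ℝ)) (hC : C.Countable) (hne : C.Nonempty) :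
    ∃ f : X →L[ℝ] ℝ, ‖f‖ = 1 ∧ ∀ g ∈ C, 1 + ‖g‖ ≤ ‖f + g‖ := by
  have := hC.to_subtype
  have := hne.to_subtype
  obtain ⟨y, f, hf, hy⟩ := aux_simul h (fun p : C × ℕ =>
    {x | x ∈ closedBall (0 : X) 1 ∧ ‖p.1.1‖ - 1 / ((p.2 : ℝ) + 1) < p.1.1 x})
    (fun p => aux_slice_s18 _ _ (by positivity))
  refine ⟨f, hf, fun g hg => ?_⟩
  refine le_of_forall_pos_lt_add (fun e he => ?_)
  obtain ⟨n, hn⟩ := exists_nat_one_div_lt he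
  obtain ⟨⟨h1, h2⟩, h3⟩ := hy (⟨g, hg⟩, n)
  have h4 := aux_apply_le (f + g) h1
  simp only [ContinuousLinearMap.add_apply] at h4
  simp only at h2
  linarith

/-- isometric `ℓ_1`-independence -/
def AuxInd (A : Set (X →L[ℝ] ℝ)) : Prop :=
  (∀ f ∈ A, ‖f‖ ≤ 1) ∧ ∀ F G : Finset (X →L[ℝ] ℝ), Disjoint F G → (F : Set (X →L[ℝ] ℝ)) ⊆ A →
    (G : Set (X →L[ℝ] ℝ)) ⊆ A → (F.card : ℝ) + G.card ≤ ‖∑ f ∈ F, f - ∑ g ∈ G, g‖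

lemma aux_finset_countable {α : Type*} {A : Set α} (hA : A.Countable) :
    {F : Finset α | (F : Set α) ⊆ A}.Countable := by
  refine ((countable_setOf_finite_subset hA).preimage_of_injOn
    (f := fun F : Finset α => (F : Set α)) Finset.coe_injective.injOn).mono ?_
  intro F hF
  exact ⟨F.finite_toSet, hF⟩

lemma aux_uncountable [CompleteSpace X]
    (h : ∀ C : Set X, IsConvexSeriesOfSlices (closedBall (0 : X) 1) C → ∃ x ∈ C, ‖x‖ = 1) :
    ∃ A : Set (X →L[ℝ] ℝ), AuxInd A ∧ ¬ A.Countable := by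
  classical
  obtain ⟨A, hA⟩ := zorn_subset {A : Set (X →L[ℝ] ℝ) | AuxInd A} (by
    intro c hc hchain
    rcases c.eq_empty_or_nonempty with rfl | hne
    · refine ⟨∅, ⟨by simp, ?_⟩, by simp⟩
      intro F G _ hF hG
      have hF' : F = ∅ := by simpa [subset_empty_iff] using hF
      have hG' : G = ∅ := by simpa [subset_empty_iff] using hG
      subst hF' hG'
      simp
    · refine ⟨⋃₀ c, ⟨?_, ?_⟩, fun s hs => subset_sUnion_of_mem hs⟩
      · rintro f ⟨s, hs, hf⟩
        exact (hc hs).1 f hf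
      · intro F G hd hF hG
        obtain ⟨s, hs, hFG⟩ := hchain.directedOn.exists_mem_subset_of_finset_subset_biUnion hne
          (s := F ∪ G) (f := fun s => s) (by
            rw [← sUnion_eq_biUnion]; push_cast; exact union_subset hF hG)
        push_cast at hFG
        exact (hc hs).2 F G hd (subset_union_left.trans hFG) (subset_union_right.trans hFG))
  have hAI : AuxInd A := hA.prop
  refine ⟨A, hAI, fun hcount => ?_⟩
  have hcf := aux_finset_countable hcount
  obtain ⟨f, hf1, hf⟩ := aux_ext h
    ((fun p : Finset (X →L[ℝ] ℝ) × Finset (X →L[ℝ] ℝ) => ∑ f ∈ p.1, f - ∑ g ∈ p.2, g) ''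
      ({F : Finset (X →L[ℝ] ℝ) | (F : Set (X →L[ℝ] ℝ)) ⊆ A} ×ˢ
        {F : Finset (X →L[ℝ] ℝ) | (F : Set (X →L[ℝ] ℝ)) ⊆ A}))
    ((hcf.prod hcf).image _) ⟨_, (∅, ∅), by simp, rfl⟩
  have hf' : ∀ F G : Finset (X →L[ℝ] ℝ), (F : Set (X →L[ℝ] ℝ)) ⊆ A → (G : Set (X →L[ℝ] ℝ)) ⊆ A →
      1 + ‖∑ f ∈ F, f - ∑ g ∈ G, g‖ ≤ ‖f + (∑ f ∈ F, f - ∑ g ∈ G, g)‖ :=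
    fun F G hF hG => hf _ ⟨(F, G), ⟨hF, hG⟩, rfl⟩
  have hfA : f ∉ A := by
    intro hfA
    have := hf' ∅ {f} (by simp) (by simpa using hfA)
    simp [hf1] at this
    linarith
  have hins : AuxInd (insert f A) := by
    refine ⟨?_, ?_⟩
    · rintro g (rfl | hg)
      · exact hf1.le
      · exact hAI.1 g hg
    · intro F G hd hF hG
      have sub : ∀ F : Finset (X →L[ℝ] ℝ), (F : Set (X →L[ℝ] ℝ)) ⊆ insert f A →
          ((F.erase f : Finset _) : Set (X →L[ℝ] ℝ)) ⊆ A := by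
        intro F hF g hg
        simp only [Finset.coe_erase, mem_diff, mem_singleton_iff] at hg
        exact (hF hg.1).resolve_left hg.2
      have hdd : Disjoint (F.erase f) (G.erase f) :=
        hd.mono (Finset.erase_subset _ _) (Finset.erase_subset _ _)
      have b1 := hAI.2 _ _ hdd (sub F hF) (sub G hG)
      have b2 := hf' _ _ (sub F hF) (sub G hG)
      have b3 := hf' _ _ (sub G hG) (sub F hF)
      by_cases h1 : f ∈ F
      · have h2 : f ∉ G := Finset.disjoint_left.1 hd h1
        rw [Finset.erase_eq_of_notMem h2] at b1 b2
        rw [← Finset.add_sum_erase F (fun g => g) h1, ← Finset.card_erase_add_one h1, add_sub_assoc]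
        push_cast
        linarith
      · rw [Finset.erase_eq_of_notMem h1] at b1 b3
        by_cases h2 : f ∈ G
        · rw [norm_sub_rev] at b1
          rw [norm_sub_rev, ← Finset.add_sum_erase G (fun g => g) h2,
            ← Finset.card_erase_add_one h2, add_sub_assoc]
          push_cast
          linarith
        · rw [Finset.erase_eq_of_notMem h2] at b1
          exact b1
  exact hfA (hA.le_of_ge hins (subset_insert f A) (mem_insert f A))

/-- The open set attached to a finite set of vectors. -/
def AuxU (P : Finset X) : Set (X →L[ℝ] ℝ) := {f | ∀ x ∈ P, 1 / 2 < f x}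

lemma aux_condense (A : Set (X →L[ℝ] ℝ)) (hA : ¬ A.Countable) (D : Set X) (hD : D.Countable) :
    ∃ A' ⊆ A, A'.Nonempty ∧ ∀ P : Finset X, (P : Set X) ⊆ D → (A' ∩ AuxU P).Nonempty →
      (A' ∩ AuxU P).Infinite := by
  set bad : Set (Finset X) := {P | (P : Set X) ⊆ D ∧ (A ∩ AuxU P).Countable} with hbad
  have hbc : bad.Countable := (aux_finset_countable hD).mono (fun P hP => hP.1)
  have hNc : (⋃ P ∈ bad, A ∩ AuxU P).Countable := hbc.biUnion (fun P hP => hP.2)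
  set N := ⋃ P ∈ bad, A ∩ AuxU P with hN
  have hunc : ∀ B : Set (X →L[ℝ] ℝ), ¬ B.Countable → ¬ (B \ N).Countable := by
    intro B hB hc
    exact hB ((hc.union hNc).mono (by intro x hx; by_cases h : x ∈ N <;> simp [h, hx]))
  refine ⟨A \ N, diff_subset, ?_, ?_⟩
  · by_contra hne
    rw [not_nonempty_iff_eq_empty] at hne
    exact hunc A hA (by rw [hne]; exact countable_empty)
  · rintro P hP ⟨f, ⟨hfA, hfN⟩, hfP⟩ hfin
    have h1 : ¬ (A ∩ AuxU P).Countable := by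
      intro hc
      exact hfN (mem_biUnion (show P ∈ bad from ⟨hP, hc⟩) ⟨hfA, hfP⟩)
    refine hunc _ h1 (hfin.countable.mono ?_)
    rintro g ⟨⟨h1, h2⟩, h3⟩
    exact ⟨⟨h1, h3⟩, h2⟩

lemma aux_step (A : Set (X →L[ℝ] ℝ)) (hA : AuxInd A) (D : Set X) (hDd : Dense D)
    (hA' : ∀ P : Finset X, (P : Set X) ⊆ D → (A ∩ AuxU P).Nonempty → (A ∩ AuxU P).Infinite)
    (U : Finset (Finset X))
    (hU : ∀ P ∈ U, (P : Set X) ⊆ D ∧ (A ∩ AuxU P).Nonempty) :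
    ∃ x ∈ D, ‖x‖ ≤ 2 ∧ ∀ P ∈ U, (∃ f ∈ A ∩ AuxU P, 1 / 2 < f x) ∧
      (∃ f ∈ A ∩ AuxU P, 1 / 2 < f (-x)) := by
  classical
  have hFG : ∃ F G : Finset (X →L[ℝ] ℝ), Disjoint F G ∧ (F : Set (X →L[ℝ] ℝ)) ⊆ A ∧
      (G : Set (X →L[ℝ] ℝ)) ⊆ A ∧ ∀ P ∈ U, (∃ f ∈ F, f ∈ AuxU P) ∧ ∃ g ∈ G, g ∈ AuxU P := by
    induction U using Finset.induction_on with
    | empty => exact ⟨∅, ∅, by simp⟩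
    | insert P U hPU ih =>
      obtain ⟨F, G, hd, hF, hG, hFG⟩ := ih (fun P hP => hU P (Finset.mem_insert_of_mem hP))
      obtain ⟨hPD, hPn⟩ := hU P (Finset.mem_insert_self _ _)
      have hinf := hA' P hPD hPn
      obtain ⟨f, hf, hfn⟩ := hinf.exists_notMem_finset (F ∪ G)
      obtain ⟨g, hg, hgn⟩ := hinf.exists_notMem_finset (insert f (F ∪ G))
      simp only [Finset.mem_union, Finset.mem_insert, not_or] at hfn hgn
      refine ⟨insert f F, insert g G, ?_, ?_, ?_, ?_⟩
      · rw [Finset.disjoint_insert_left, Finset.disjoint_insert_right]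
        simp only [Finset.mem_insert, not_or]
        exact ⟨⟨fun h => hgn.1 h.symm, hfn.2⟩, hgn.2.1, hd⟩
      · push_cast; exact insert_subset hf.1 hF
      · push_cast; exact insert_subset hg.1 hG
      · intro Q hQ
        rcases Finset.mem_insert.1 hQ with rfl | hQ
        · exact ⟨⟨f, Finset.mem_insert_self _ _, hf.2⟩, ⟨g, Finset.mem_insert_self _ _, hg.2⟩⟩
        · obtain ⟨⟨a, ha, ha'⟩, ⟨b, hb, hb'⟩⟩ := hFG Q hQ
          exact ⟨⟨a, Finset.mem_insert_of_mem ha, ha'⟩, ⟨b, Finset.mem_insert_of_mem hb, hb'⟩⟩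
  obtain ⟨F, G, hd, hF, hG, hFG⟩ := hFG
  obtain ⟨x, hx, hlt⟩ := aux_norming (∑ f ∈ F, f - ∑ g ∈ G, g) (1 / 4) (by norm_num)
  have hlb := hA.2 F G hd hF hG
  have hxn : ‖x‖ ≤ 1 := by simpa using hx
  have hxn' : -x ∈ closedBall (0 : X) 1 := by simpa using hxn
  obtain ⟨d, hdD, hdx⟩ := hDd.exists_dist_lt x (show (0 : ℝ) < 1 / 4 by norm_num)
  rw [dist_eq_norm] at hdx
  have hle : ∀ f ∈ A, ∀ z ∈ closedBall (0 : X) 1, f z ≤ 1 := fun f hf z hz =>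
    (aux_apply_le f hz).trans (hA.1 f hf)
  have happ : (∑ f ∈ F, f - ∑ g ∈ G, g) x = ∑ f ∈ F, f x + ∑ g ∈ G, g (-x) := by
    simp [sub_eq_add_neg]
  have htot : ∑ f ∈ F, (1 - f x) + ∑ g ∈ G, (1 - g (-x)) < 1 / 4 := by
    rw [Finset.sum_sub_distrib, Finset.sum_sub_distrib]
    simp only [Finset.sum_const, nsmul_eq_mul, mul_one]
    linarith
  have n1 : ∀ f ∈ F, 0 ≤ 1 - f x := fun f hf => by linarith [hle f (hF hf) x hx]
  have n2 : ∀ g ∈ G, 0 ≤ 1 - g (-x) := fun g hg => by linarith [hle g (hG hg) (-x) hxn']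
  have hdiff : ∀ f ∈ A, |f x - f d| < 1 / 4 := by
    intro f hf
    rw [← map_sub]
    calc |f (x - d)| ≤ ‖f‖ * ‖x - d‖ := f.le_opNorm _
      _ ≤ 1 * ‖x - d‖ := by gcongr; exact hA.1 f hf
      _ < 1 / 4 := by linarith
  refine ⟨d, hdD, ?_, fun P hP => ?_⟩
  · have := norm_sub_norm_le d x
    rw [norm_sub_rev] at this
    linarith
  · obtain ⟨⟨f, hf, hfP⟩, ⟨g, hg, hgP⟩⟩ := hFG P hP
    refine ⟨⟨f, ⟨hF hf, hfP⟩, ?_⟩, ⟨g, ⟨hG hg, hgP⟩, ?_⟩⟩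
    · have t1 := Finset.single_le_sum n1 hf
      have t2 := Finset.sum_nonneg n2
      have t3 := abs_lt.1 (hdiff f (hF hf))
      linarith
    · have t1 := Finset.single_le_sum n2 hg
      have t2 := Finset.sum_nonneg n1
      have t3 := abs_lt.1 (hdiff g (hG hg))
      rw [map_neg] at t1 ⊢
      linarith

lemma aux_seq_s18 [TopologicalSpace.SeparableSpace X] (A₀ : Set (X →L[ℝ] ℝ)) (hA₀ : AuxInd A₀)
    (hunc : ¬ A₀.Countable) :
    ∃ x : ℕ → X, (∀ n, ‖x n‖ ≤ 2) ∧ ∀ (s : ℕ → Bool) (n : ℕ), ∃ f : X →L[ℝ] ℝ, ‖f‖ ≤ 1 ∧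
      ∀ i < n, 1 / 2 < f (if s i then x i else - x i) := by
  classical
  obtain ⟨D₀, hD₀c, hD₀⟩ := TopologicalSpace.exists_countable_dense X
  set D : Set X := D₀ ∪ (fun x => -x) '' D₀ with hDdef
  have hDc : D.Countable := hD₀c.union (hD₀c.image _)
  have hDd : Dense D := hD₀.mono subset_union_left
  have hDneg : ∀ x ∈ D, -x ∈ D := by
    rintro x (hx | ⟨y, hy, rfl⟩)
    · exact Or.inr ⟨x, hx, rfl⟩
    · left; simpa using hy
  obtain ⟨A, hAA, hAne, hAinf⟩ := aux_condense A₀ hunc D hDc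
  have hA : AuxInd A := ⟨fun f hf => hA₀.1 f (hAA hf), fun F G hd hF hG =>
    hA₀.2 F G hd (hF.trans hAA) (hG.trans hAA)⟩
  let St := {U : Finset (Finset X) // ∀ P ∈ U, (P : Set X) ⊆ D ∧ (A ∩ AuxU P).Nonempty}
  have step : ∀ U : St, ∃ (x : X) (V : St), ‖x‖ ≤ 2 ∧ ∀ P ∈ U.1, insert x P ∈ V.1 ∧
      insert (-x) P ∈ V.1 := by
    rintro ⟨U, hU⟩
    obtain ⟨x, hxD, hx2, hx⟩ := aux_step A hA D hDd hAinf U hU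
    refine ⟨x, ⟨U.image (insert x) ∪ U.image (insert (-x)), ?_⟩, hx2, ?_⟩
    · intro Q hQ
      simp only [Finset.mem_union, Finset.mem_image] at hQ
      rcases hQ with ⟨P, hP, rfl⟩ | ⟨P, hP, rfl⟩
      · refine ⟨by push_cast; exact insert_subset hxD (hU P hP).1, ?_⟩
        obtain ⟨f, ⟨hfA, hfP⟩, hfx⟩ := (hx P hP).1
        refine ⟨f, hfA, fun z hz => ?_⟩
        rcases Finset.mem_insert.1 hz with rfl | hz
        · exact hfx
        · exact hfP z hz
      · refine ⟨by push_cast; exact insert_subset (hDneg x hxD) (hU P hP).1, ?_⟩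
        obtain ⟨f, ⟨hfA, hfP⟩, hfx⟩ := (hx P hP).2
        refine ⟨f, hfA, fun z hz => ?_⟩
        rcases Finset.mem_insert.1 hz with rfl | hz
        · exact hfx
        · exact hfP z hz
    · intro P hP
      simp only [Finset.mem_union, Finset.mem_image]
      exact ⟨Or.inl ⟨P, hP, rfl⟩, Or.inr ⟨P, hP, rfl⟩⟩
  choose nx nU hn2 hnU using step
  let U0 : St := ⟨{∅}, by
    intro P hP
    rw [Finset.mem_singleton] at hP
    subst hP
    obtain ⟨f, hf⟩ := hAne
    exact ⟨by simp, f, hf, fun x hx => by simp at hx⟩⟩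
  let U : ℕ → St := fun n => Nat.rec U0 (fun _ V => nU V) n
  refine ⟨fun n => nx (U n), fun n => hn2 _, fun s n => ?_⟩
  have key : ∀ n, ∃ P ∈ (U n).1, ∀ i < n, (if s i then nx (U i) else - nx (U i)) ∈ P := by
    intro n
    induction n with
    | zero => exact ⟨∅, by simp [U, U0], by simp⟩
    | succ n ih =>
      obtain ⟨P, hP, hPi⟩ := ih
      refine ⟨insert (if s n then nx (U n) else - nx (U n)) P, ?_, ?_⟩
      · have := hnU (U n) P hP
        change _ ∈ (nU (U n)).1
        cases s n
        · simpa using this.2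
        · simpa using this.1
      · intro i hi
        rcases Nat.lt_succ_iff_lt_or_eq.1 hi with hi | rfl
        · exact Finset.mem_insert_of_mem (hPi i hi)
        · exact Finset.mem_insert_self _ _
  obtain ⟨P, hP, hPi⟩ := key n
  obtain ⟨f, hfA, hfP⟩ := ((U n).2 P hP).2
  exact ⟨f, hA.1 f hfA, fun i hi => hfP _ (hPi i hi)⟩

lemma aux_lower (x : ℕ → X)
    (hx : ∀ (s : ℕ → Bool) (n : ℕ), ∃ f : X →L[ℝ] ℝ, ‖f‖ ≤ 1 ∧
      ∀ i < n, 1 / 2 < f (if s i then x i else - x i)) (c : ℕ → ℝ) (n : ℕ) :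
    1 / 2 * ∑ i ∈ Finset.range n, |c i| ≤ ‖∑ i ∈ Finset.range n, c i • x i‖ := by
  obtain ⟨f, hf, hfi⟩ := hx (fun i => decide (0 ≤ c i)) n
  calc 1 / 2 * ∑ i ∈ Finset.range n, |c i| ≤ ∑ i ∈ Finset.range n, c i * f (x i) := by
        rw [Finset.mul_sum]
        refine Finset.sum_le_sum (fun i hi => ?_)
        have := hfi i (Finset.mem_range.1 hi)
        by_cases h0 : 0 ≤ c i
        · simp only [h0, decide_true, if_true] at this
          rw [abs_of_nonneg h0]
          nlinarith
        · simp only [h0, decide_false, Bool.false_eq_true, if_false, map_neg] at this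
          rw [abs_of_neg (not_le.1 h0)]
          nlinarith
    _ = f (∑ i ∈ Finset.range n, c i • x i) := by simp [map_sum]
    _ ≤ ‖f (∑ i ∈ Finset.range n, c i • x i)‖ := le_abs_self _
    _ ≤ ‖f‖ * ‖∑ i ∈ Finset.range n, c i • x i‖ := f.le_opNorm _
    _ ≤ 1 * ‖∑ i ∈ Finset.range n, c i • x i‖ := by gcongr
    _ = _ := one_mul _

lemma aux_embed [CompleteSpace X] (x : ℕ → X) (hx2 : ∀ n, ‖x n‖ ≤ 2)
    (hlow : ∀ (c : ℕ → ℝ) (n : ℕ),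
      1 / 2 * ∑ i ∈ Finset.range n, |c i| ≤ ‖∑ i ∈ Finset.range n, c i • x i‖) :
    ∃ T : lp (fun _ : ℕ => ℝ) 1 →L[ℝ] X, Function.Injective T ∧
        ∃ c : ℝ, 0 < c ∧ ∀ v, c * ‖v‖ ≤ ‖T v‖ := by
  have hs : ∀ v : lp (fun _ : ℕ => ℝ) 1, HasSum (fun i => |v i|) ‖v‖ := by
    intro v
    have := lp.hasSum_norm (p := 1) (by simp) v
    simpa using this
  have hb : ∀ (v : lp (fun _ : ℕ => ℝ) 1) (i : ℕ), ‖v i • x i‖ ≤ |v i| * 2 := by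
    intro v i
    rw [norm_smul, Real.norm_eq_abs]
    exact mul_le_mul_of_nonneg_left (hx2 i) (abs_nonneg _)
  have hsx : ∀ v : lp (fun _ : ℕ => ℝ) 1, Summable (fun i => v i • x i) := fun v =>
    Summable.of_norm_bounded ((hs v).summable.mul_right 2) (hb v)
  let L : lp (fun _ : ℕ => ℝ) 1 →ₗ[ℝ] X :=
    { toFun := fun v => ∑' i, v i • x i
      map_add' := fun v w => by
        rw [← (hsx v).tsum_add (hsx w)]
        simp [add_smul]
      map_smul' := fun a v => by
        simp only [RingHom.id_apply]
        rw [← (hsx v).tsum_const_smul a]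
        simp [mul_smul] }
  let T : lp (fun _ : ℕ => ℝ) 1 →L[ℝ] X := L.mkContinuous 2 (fun v => by
    have := tsum_of_norm_bounded ((hs v).mul_right 2) (hb v)
    rw [mul_comm]
    exact this)
  have hT : ∀ v, 1 / 2 * ‖v‖ ≤ ‖T v‖ := by
    intro v
    have t1 := (hs v).tendsto_sum_nat.const_mul (1 / 2)
    have t2 := (hsx v).hasSum.tendsto_sum_nat.norm
    exact le_of_tendsto_of_tendsto' t1 t2 (fun n => hlow (fun i => v i) n)
  refine ⟨T, ?_, 1 / 2, by norm_num, hT⟩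
  rw [injective_iff_map_eq_zero]
  intro v hv
  have := hT v
  rw [hv, norm_zero] at this
  exact norm_le_zero_iff.1 (by linarith)

end Aux

/-- if every convex series of slices of `B_X` meets the unit sphere, then
`B_X` has no SCD points; if moreover `X` is separable, then `X` contains an isomorphic
copy of `ℓ_1`. -/
theorem stmt18 {X : Type*} [NormedAddCommGroup X] [NormedSpace ℝ X] [CompleteSpace X]
    (h : ∀ C : Set X, IsConvexSeriesOfSlices (Metric.closedBall (0 : X) 1) C →
      ∃ x ∈ C, ‖x‖ = 1) :
    {a | SCDPoint (Metric.closedBall (0 : X) 1) a} = ∅ ∧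
    (TopologicalSpace.SeparableSpace X →
      ∃ T : lp (fun _ : ℕ => ℝ) 1 →L[ℝ] X, Function.Injective T ∧
        ∃ c : ℝ, 0 < c ∧ ∀ v, c * ‖v‖ ≤ ‖T v‖) := by
  refine ⟨aux_noSCD h, fun hsep => ?_⟩
  obtain ⟨A, hA, hunc⟩ := aux_uncountable h
  obtain ⟨x, hx2, hx⟩ := aux_seq_s18 A hA hunc
  exact aux_embed x hx2 (aux_lower x hx)
end
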